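/- arXiv:math/0512335 — 3 statements merged into one kernel-verified Lean document; each statement's English description precedes it below -/
import Mathlib

section
/- Let n be a positive integer and let f : ℝⁿ → ℝⁿ be a real analytic map which is open (it maps open sets onto open sets). Then the Jacobian of f does not change sign: either det(df_p) ≥ 0 for all p ∈ ℝⁿ, or det(df_p) ≤ 0 for all p ∈ ℝⁿ. -/
open Filter Topology Set

section
variable {X F : Type*} [NormedAddCommGroup X] [NormedSpace ℝ X]
  [NormedAddCommGroup F] [NormedSpace ℝ F] [CompleteSpace F]

lemma flat_line {b : X → F} {x e : X} (hb : AnalyticAt ℝ b x)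
    (h : ∀ j, iteratedFDeriv ℝ j b x (fun _ => e) = 0) :
    ∀ᶠ t : ℝ in 𝓝 0, b (x + t • e) = 0 := by
  obtain ⟨p, r, hp⟩ := hb
  have hc : Tendsto (fun t : ℝ => t • e) (𝓝 0) (𝓝 0) := by
    have : Continuous (fun t : ℝ => t • e) := by fun_prop
    simpa using this.tendsto 0
  filter_upwards [hc.eventually (Metric.eball_mem_nhds (0:X) hp.r_pos)] with t ht
  have hs := hp.hasSum ht
  have hz : ∀ n, p n (fun _ => t • e) = 0 := by
    intro n
    have h1 := hp.factorial_smul (t • e) n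
    have h2 := (iteratedFDeriv ℝ n b x).map_smul_univ (fun _ => t) (fun _ => e)
    rw [h2, h n, smul_zero] at h1
    have : ((n.factorial : ℕ)) ≠ 0 := Nat.factorial_ne_zero n
    rw [← Nat.cast_smul_eq_nsmul ℝ] at h1
    exact (smul_eq_zero.1 h1).resolve_left (by exact_mod_cast this)
  simp only [hz] at hs
  exact hs.unique hasSum_zero

lemma flat_pt {b : X → F} {x : X} (hb : AnalyticAt ℝ b x)
    (h : ∀ j, iteratedFDeriv ℝ j b x = 0) :
    ∀ᶠ y in 𝓝 x, b y = 0 := by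
  obtain ⟨p, r, hp⟩ := hb
  filter_upwards [Metric.eball_mem_nhds x hp.r_pos] with y hy
  have hs := hp.hasSum_sub hy
  have hz : ∀ n, p n (fun _ => y - x) = 0 := by
    intro n
    have h1 := hp.factorial_smul (y - x) n
    rw [h n] at h1
    have : ((n.factorial : ℕ)) ≠ 0 := Nat.factorial_ne_zero n
    rw [← Nat.cast_smul_eq_nsmul ℝ] at h1
    exact (smul_eq_zero.1 h1).resolve_left (by exact_mod_cast this)
  simp only [hz] at hs
  exact hs.unique hasSum_zero
end

section
variable {E : Type*} [NormedAddCommGroup E] [NormedSpace ℝ E] [FiniteDimensional ℝ E]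

/-- connected sets avoiding the sign-change set -/
lemma sign_of_preconnected {J : E → ℝ} (hc : Continuous J) (hd : Dense {x | J x ≠ 0}) {s : Set E}
    (hs : IsPreconnected s) (h : ∀ x ∈ s, ¬ (x ∈ closure {x | 0 < J x} ∧ x ∈ closure {x | J x < 0})) :
    (∀ x ∈ s, 0 ≤ J x) ∨ (∀ x ∈ s, J x ≤ 0) := by
  have hle : ∀ x ∈ closure {x | 0 < J x}, 0 ≤ J x := fun x hx =>
    closure_minimal (fun y (hy : 0 < J y) => hy.le) (isClosed_le continuous_const hc) hx
  have hge : ∀ x ∈ closure {x | J x < 0}, J x ≤ 0 := fun x hx =>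
    closure_minimal (fun y (hy : J y < 0) => hy.le) (isClosed_le hc continuous_const) hx
  have hcov : s ⊆ closure {x | 0 < J x} ∪ closure {x | J x < 0} := by
    intro x _
    rw [← closure_union]
    refine closure_mono ?_ (hd x)
    intro y hy
    rcases lt_or_gt_of_ne hy with h | h
    · exact Or.inr h
    · exact Or.inl h
  by_contra hcon
  push Not at hcon
  obtain ⟨⟨x, hx, hx'⟩, ⟨y, hy, hy'⟩⟩ := hcon
  have := isPreconnected_closed_iff.1 hs _ _ isClosed_closure isClosed_closure hcov
    ⟨y, hy, subset_closure hy'⟩ ⟨x, hx, subset_closure hx'⟩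
  obtain ⟨z, hz, hz'⟩ := this
  exact h z hz hz'

lemma exists_defining {J : E → ℝ} (hJ : ∀ x, AnalyticAt ℝ J x) {a b : E} (ha : 0 < J a)
    (hb : J b < 0) :
    ∃ (p : E) (g : E → ℝ), (∀ x, AnalyticAt ℝ g x) ∧ 
      p ∈ closure {x | 0 < J x} ∧ p ∈ closure {x | J x < 0} ∧
      fderiv ℝ g p ≠ 0 ∧
      ∀ x, x ∈ closure {x | 0 < J x} → x ∈ closure {x | J x < 0} → g x = 0 := by
  have hc : Continuous J := continuous_iff_continuousAt.2 fun x => (hJ x).continuousAt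
  have hle : ∀ x ∈ closure {x | 0 < J x}, 0 ≤ J x := fun x hx =>
    closure_minimal (fun y (hy : 0 < J y) => hy.le) (isClosed_le continuous_const hc) hx
  have hge : ∀ x ∈ closure {x | J x < 0}, J x ≤ 0 := fun x hx =>
    closure_minimal (fun y (hy : J y < 0) => hy.le) (isClosed_le hc continuous_const) hx
  have hnz : ∀ x, ¬ (∀ᶠ y in 𝓝 x, J y = 0) := by
    intro x hx
    have := AnalyticOnNhd.eqOn_zero_of_preconnected_of_eventuallyEq_zero
      (fun y _ => hJ y : AnalyticOnNhd ℝ J univ) isPreconnected_univ (mem_univ x) hx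
    have := this (mem_univ a)
    simp at this
    linarith
  have hd : Dense {x | J x ≠ 0} := by
    intro x
    rw [mem_closure_iff_frequently]
    intro h
    exact hnz x (h.mono fun y hy => by simpa using hy)
  have hex : ∃ m, ∃ p, (p ∈ closure {x | 0 < J x} ∧ p ∈ closure {x | J x < 0}) ∧
      iteratedFDeriv ℝ m J p ≠ 0 := by
    by_contra hcon
    push Not at hcon
    rcases sign_of_preconnected hc hd isPreconnected_univ (fun x _ hx => 
      hnz x (flat_pt (hJ x) fun m => hcon m x hx)) with h | h
    · exact absurd (h b (mem_univ _)) (not_le.2 hb)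
    · exact absurd (h a (mem_univ _)) (not_le.2 ha)
  classical
  obtain ⟨p, hp, hne⟩ := Nat.find_spec hex
  have hmin := fun k => Nat.find_min hex (m := k)
  rcases hm : Nat.find hex with _ | m
  · exfalso
    rw [hm] at hne
    apply hne
    ext v
    simp only [iteratedFDeriv_zero_apply]
    exact le_antisymm (hge p hp.2) (hle p hp.1)
  · rw [hm] at hne hmin
    have h0 : ∀ x, x ∈ closure {x | 0 < J x} → x ∈ closure {x | J x < 0} → 
        iteratedFDeriv ℝ m J x = 0 := by
      intro x h1 h2
      by_contra h3
      exact hmin m (Nat.lt_succ_self m) ⟨x, ⟨h1, h2⟩, h3⟩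
    have : ∃ v, iteratedFDeriv ℝ (m+1) J p v ≠ 0 := by
      by_contra h; push Not at h
      exact hne (by ext v; simpa using h v)
    obtain ⟨v, hv⟩ := this
    rw [iteratedFDeriv_succ_apply_left] at hv
    have han : ∀ x, AnalyticAt ℝ (iteratedFDeriv ℝ m J) x := fun x =>
      AnalyticOnNhd.iteratedFDeriv (fun y _ => hJ y : AnalyticOnNhd ℝ J univ) m x (mem_univ x)
    let ev := ContinuousMultilinearMap.apply ℝ (fun _ : Fin m => E) ℝ (Fin.tail v)
    refine ⟨p, fun x => ev (iteratedFDeriv ℝ m J x), ?_, hp.1, hp.2, ?_, ?_⟩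
    · intro x
      exact (ev.analyticAt _).comp (han x)
    · intro h
      apply hv
      have h1 := (ev.hasFDerivAt.comp p (han p).differentiableAt.hasFDerivAt).fderiv
      have h2 : fderiv ℝ (fun x => ev (iteratedFDeriv ℝ m J x)) p (v 0) = 0 := by rw [h]; rfl
      change fderiv ℝ (ev ∘ (iteratedFDeriv ℝ m J)) p (v 0) = 0 at h2
      rw [h1] at h2
      exact h2
    · intro x h1 h2
      simp [h0 x h1 h2]

lemma exists_side {J : E → ℝ} (hJ : ∀ x, AnalyticAt ℝ J x) {a b : E} (ha : 0 < J a)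
    (hb : J b < 0) :
    ∃ (p : E) (g : E → ℝ), (∀ x, AnalyticAt ℝ g x) ∧ g p = 0 ∧ fderiv ℝ g p ≠ 0 ∧
      ∀ᶠ x in 𝓝 p, (0 < g x → 0 ≤ J x) ∧ (g x < 0 → J x ≤ 0) := by
  obtain ⟨p, g, hg, hp1, hp2, hdg, hz⟩ := exists_defining hJ ha hb
  have hc : Continuous J := continuous_iff_continuousAt.2 fun x => (hJ x).continuousAt
  have hd : Dense {x | J x ≠ 0} := by
    intro x
    rw [mem_closure_iff_frequently]
    intro h
    have := AnalyticOnNhd.eqOn_zero_of_preconnected_of_eventuallyEq_zero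
      (fun y _ => hJ y : AnalyticOnNhd ℝ J univ) isPreconnected_univ (mem_univ x) 
        (h.mono fun y hy => by simpa using hy)
    have := this (mem_univ a)
    simp at this
    linarith
  have hgp : g p = 0 := hz p hp1 hp2
  have hgc : Continuous g := continuous_iff_continuousAt.2 fun x => (hg x).continuousAt
  have hs : HasStrictFDerivAt g (fderiv ℝ g p) p := (hg p).hasStrictFDerivAt
  have hsurj : (fderiv ℝ g p).range = ⊤ := by
    rw [LinearMap.range_eq_top]
    apply LinearMap.surjective
    intro h
    exact hdg (by ext v; exact congrArg (fun l => l v) h)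
  let e := hs.implicitToOpenPartialHomeomorph g _ hsurj
  have hef : ∀ x, (e x).1 = g x := hs.implicitToOpenPartialHomeomorph_fst hsurj
  have hpe : p ∈ e.source := hs.mem_implicitToOpenPartialHomeomorph_source hsurj
  obtain ⟨ε, hε, hball⟩ := Metric.isOpen_iff.1 e.open_target (e p) (e.map_source hpe)
  let B := Metric.ball (e p) ε
  have hBc : Convex ℝ B := convex_ball _ _
  have hgs : ∀ y ∈ B, g (e.symm y) = y.1 := by
    intro y hy
    rw [← hef, e.right_inv (hball hy)]
  have key : ∀ s : Set ℝ, Convex ℝ s → (0:ℝ) ∉ s → 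
      (∀ x ∈ e.symm '' (B ∩ Prod.fst ⁻¹' s), 0 ≤ J x) ∨ (∀ x ∈ e.symm '' (B ∩ Prod.fst ⁻¹' s), J x ≤ 0) := by
    intro s hs h0
    apply sign_of_preconnected hc hd
    · apply IsPreconnected.image
      · apply Convex.isPreconnected
        exact hBc.inter (hs.linear_preimage (LinearMap.fst ℝ ℝ _))
      · exact e.continuousOn_symm.mono (inter_subset_left.trans hball)
    · rintro x ⟨y, ⟨hy, hys⟩, rfl⟩ ⟨h1, h2⟩
      have := hz _ h1 h2
      rw [hgs y hy] at this
      exact h0 (this ▸ hys)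
  have hU : ∀ᶠ x in 𝓝 p, x ∈ e.source ∧ e x ∈ B :=
    (e.open_source.eventually_mem hpe).and 
      ((e.continuousAt hpe).eventually (Metric.ball_mem_nhds _ hε))
  have hmem : ∀ x, x ∈ e.source ∧ e x ∈ B → ∀ s : Set ℝ, g x ∈ s → x ∈ e.symm '' (B ∩ Prod.fst ⁻¹' s) := by
    intro x hx s hgs
    exact ⟨e x, ⟨hx.2, by simpa [hef] using hgs⟩, e.left_inv hx.1⟩
  -- g ≠ 0 is dense near p
  have hreg : ∀ᶠ x in 𝓝 p, fderiv ℝ g x ≠ 0 := by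
    have : ContinuousAt (fderiv ℝ g) p := (hg p).fderiv.continuousAt
    exact this.eventually_ne hdg
  have hdens : ∀ᶠ x in 𝓝 p, ∃ᶠ y in 𝓝 x, g y ≠ 0 := by
    filter_upwards [hreg] with x hx h
    apply hx
    have h' : g =ᶠ[𝓝 x] fun _ => 0 := h.mono fun y hy => by simpa using hy
    rw [h'.fderiv_eq]; simp
  have hopp : ∀ U : Set E, U ∈ 𝓝 p → (∃ x ∈ U, g x ≠ 0 ∧ 0 < J x) ∧ (∃ x ∈ U, g x ≠ 0 ∧ J x < 0) := by
    intro U hU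
    obtain ⟨V, hVU, hVo, hpV⟩ := mem_nhds_iff.1 (inter_mem hU hdens)
    constructor
    · obtain ⟨x, hx, hxJ⟩ := mem_closure_iff.1 hp1 V hVo hpV
      obtain ⟨y, hy, hy'⟩ := ((hVU hx).2.and_eventually 
        ((hVo.eventually_mem hx).and (hc.continuousAt.eventually (lt_mem_nhds hxJ)))).exists
      exact ⟨y, (hVU hy'.1).1, hy, hy'.2⟩
    · obtain ⟨x, hx, hxJ⟩ := mem_closure_iff.1 hp2 V hVo hpV
      obtain ⟨y, hy, hy'⟩ := ((hVU hx).2.and_eventually 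
        ((hVo.eventually_mem hx).and (hc.continuousAt.eventually (gt_mem_nhds hxJ)))).exists
      exact ⟨y, (hVU hy'.1).1, hy, hy'.2⟩
  obtain ⟨⟨x1, hx1, hx1g, hx1J⟩, ⟨x2, hx2, hx2g, hx2J⟩⟩ := hopp _ hU
  rcases key (Ioi 0) (convex_Ioi 0) (by simp) with h1 | h1 <;>
  rcases key (Iio 0) (convex_Iio 0) (by simp) with h2 | h2
  · exfalso
    rcases lt_or_gt_of_ne hx2g with h | h
    · exact absurd (h2 x2 (hmem x2 hx2 _ h)) (not_le.2 hx2J)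
    · exact absurd (h1 x2 (hmem x2 hx2 _ h)) (not_le.2 hx2J)
  · refine ⟨p, g, hg, hgp, hdg, ?_⟩
    filter_upwards [hU] with x hx
    exact ⟨fun h => h1 x (hmem x hx _ h), fun h => h2 x (hmem x hx _ h)⟩
  · refine ⟨p, fun x => - g x, fun x => (hg x).neg, by simp [hgp], ?_, ?_⟩
    · rw [fderiv_fun_neg]; simpa using hdg
    filter_upwards [hU] with x hx
    exact ⟨fun h => h2 x (hmem x hx _ (by simpa using h)), fun h => h1 x (hmem x hx _ (by simpa using h))⟩
  · exfalso
    rcases lt_or_gt_of_ne hx1g with h | h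
    · exact absurd (h2 x1 (hmem x1 hx1 _ h)) (not_le.2 hx1J)
    · exact absurd (h1 x1 (hmem x1 hx1 _ h)) (not_le.2 hx1J)
end
section
variable {S E : Type*} [NormedAddCommGroup S] [NormedSpace ℝ S]
  [NormedAddCommGroup E] [NormedSpace ℝ E] [CompleteSpace E]

lemma mem_ball_prod {s0 : S} {ε : ℝ} {y : S × ℝ} :
    y ∈ Metric.ball (s0, (0:ℝ)) ε ↔ y.1 ∈ Metric.ball s0 ε ∧ |y.2| < ε := by
  rw [← ball_prod_same]
  simp [Set.mem_prod]

lemma order_dichotomy {b : S × ℝ → E} {s0 : S} {ε : ℝ}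
    (hb : AnalyticOnNhd ℝ b (Metric.ball (s0, (0:ℝ)) ε)) :
    (∀ y ∈ Metric.ball (s0, (0:ℝ)) ε, b y = 0) ∨
    ∃ s1 : S, ∃ μ : E →L[ℝ] ℝ, ∃ δ > 0,
      Metric.ball (s1, (0:ℝ)) δ ⊆ Metric.ball (s0, (0:ℝ)) ε ∧
      ∀ y ∈ Metric.ball (s1, (0:ℝ)) δ, y.2 ≠ 0 → μ (b y) ≠ 0 := by
  set B := Metric.ball (s0, (0:ℝ)) ε with hB
  let e : S × ℝ := (0, 1)
  by_cases hex : ∃ k, ∃ s, (s, (0:ℝ)) ∈ B ∧ iteratedFDeriv ℝ k b (s, 0) (fun _ => e) ≠ 0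
  · right
    classical
    obtain ⟨s1, hs1, hne⟩ := Nat.find_spec hex
    have hmin : ∀ j < Nat.find hex, ∀ s, (s, (0:ℝ)) ∈ B →
        iteratedFDeriv ℝ j b (s, 0) (fun _ => e) = 0 := by
      intro j hj s hs
      by_contra h
      exact Nat.find_min hex hj ⟨s, hs, h⟩
    generalize Nat.find hex = k at hne hmin
    obtain ⟨μ, hμ⟩ := SeparatingDual.exists_ne_zero (R := ℝ) hne
    have han : ∀ j, AnalyticOnNhd ℝ (iteratedFDeriv ℝ j b) B := fun j =>
      hb.iteratedFDeriv j
    let ev : ∀ j : ℕ, ((S × ℝ) [×j]→L[ℝ] E) →L[ℝ] E := fun j =>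
      ContinuousMultilinearMap.apply ℝ (fun _ : Fin j => S × ℝ) E (fun _ => e)
    let H : ℕ → S × ℝ → ℝ := fun j y => μ (ev j (iteratedFDeriv ℝ j b y))
    have hHd : ∀ j, ∀ y ∈ B, HasFDerivAt (H j)
        (μ.comp ((ev j).comp (fderiv ℝ (iteratedFDeriv ℝ j b) y))) y := by
      intro j y hy
      exact μ.hasFDerivAt.comp y ((ev j).hasFDerivAt.comp y
        (han j y hy).differentiableAt.hasFDerivAt)
    have hH1 : ∀ j s (t : ℝ), (s, t) ∈ B → HasDerivAt (fun t => H j (s, t)) (H (j+1) (s, t)) t := by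
      intro j s t hy
      have h1 : HasDerivAt (fun t : ℝ => (s, t)) e t :=
        (hasDerivAt_const t s).prodMk (hasDerivAt_id t)
      have h2 := (hHd j _ hy).comp_hasDerivAt t h1
      refine h2.congr_deriv ?_
      symm
      change μ (iteratedFDeriv ℝ (j+1) b (s, t) (fun _ => e)) = _
      rw [iteratedFDeriv_succ_apply_left]
      rfl
    have hcont : ContinuousAt (H k) (s1, 0) := (hHd k _ hs1).continuousAt
    have hnz : ∀ᶠ y in 𝓝 (s1, (0:ℝ)), H k y ≠ 0 := hcont.eventually_ne hμ
    obtain ⟨δ, hδ, hball⟩ := Metric.eventually_nhds_iff_ball.1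
      (hnz.and (Metric.isOpen_ball.eventually_mem hs1))
    refine ⟨s1, μ, δ, hδ, fun y hy => (hball y hy).2, ?_⟩
    have hind : ∀ i j, i + j = k → ∀ y ∈ Metric.ball (s1, (0:ℝ)) δ, y.2 ≠ 0 → H j y ≠ 0 := by
      intro i
      induction i with
      | zero => 
        intro j hj y hy _
        obtain rfl : j = k := by omega
        exact (hball y hy).1
      | succ i ih =>
        intro j hj y hy hy2 h0
        have ih' := ih (j+1) (by omega)
        obtain ⟨s, t⟩ := y
        have hm := mem_ball_prod.1 hy
        simp only at hm hy2
        have hin : ∀ τ ∈ uIcc 0 t, (s, τ) ∈ Metric.ball (s1, (0:ℝ)) δ := by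
          intro τ hτ
          refine mem_ball_prod.2 ⟨hm.1, lt_of_le_of_lt ?_ hm.2⟩
          have := abs_sub_left_of_mem_uIcc hτ
          simpa using this
        have hz : H j (s, 0) = 0 := by
          have := hmin j (by omega) s (hball _ (hin 0 left_mem_uIcc)).2
          simp only [H, ev, ContinuousMultilinearMap.apply_apply]
          rw [this, map_zero]
        rcases lt_or_gt_of_ne hy2 with hlt | hgt
        · rw [uIcc_of_ge hlt.le] at hin
          obtain ⟨c, hc, hc'⟩ := exists_hasDerivAt_eq_zero hlt
            (fun τ hτ => (hH1 j s τ (hball _ (hin τ hτ)).2).continuousAt.continuousWithinAt)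
            (h0.trans hz.symm) (fun τ hτ => hH1 j s τ (hball _ (hin τ (Ioo_subset_Icc_self hτ))).2)
          exact ih' (s, c) (hin c (Ioo_subset_Icc_self hc)) hc.2.ne hc'
        · rw [uIcc_of_le hgt.le] at hin
          obtain ⟨c, hc, hc'⟩ := exists_hasDerivAt_eq_zero hgt
            (fun τ hτ => (hH1 j s τ (hball _ (hin τ hτ)).2).continuousAt.continuousWithinAt)
            (hz.trans h0.symm) (fun τ hτ => hH1 j s τ (hball _ (hin τ (Ioo_subset_Icc_self hτ))).2)
          exact ih' (s, c) (hin c (Ioo_subset_Icc_self hc)) hc.1.ne' hc'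
    intro y hy hy2
    have := hind k 0 (by omega) y hy hy2
    simpa [H, ev] using this
  · left
    push Not at hex
    rintro ⟨s, t⟩ hy
    have hm := mem_ball_prod.1 hy
    simp only at hm
    have hε : 0 < ε := (abs_nonneg _).trans_lt hm.2
    have hin : ∀ τ : ℝ, |τ| < ε → (s, τ) ∈ B := fun τ hτ => mem_ball_prod.2 ⟨hm.1, hτ⟩
    have hs0 := hin 0 (by simpa using hε)
    have h1 := flat_line (hb _ hs0) (fun j => hex j s hs0)
    have h2 : AnalyticOnNhd ℝ (fun τ : ℝ => b (s, τ)) (Ioo (-ε) ε) := by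
      intro τ hτ
      exact (hb _ (hin τ (abs_lt.2 hτ))).comp_of_eq (analyticAt_const.prod analyticAt_id) rfl
    have h3 := h2.eqOn_zero_of_preconnected_of_eventuallyEq_zero isPreconnected_Ioo
      (z₀ := (0:ℝ)) ⟨by linarith, hε⟩ (h1.mono fun τ hτ => by simpa [e] using hτ)
    exact @h3 t (abs_lt.1 hm.2)
end

section
variable {R K E : Type*} [NormedAddCommGroup R] [NormedSpace ℝ R]
  [NormedAddCommGroup K] [NormedSpace ℝ K]
  [NormedAddCommGroup E] [NormedSpace ℝ E] [CompleteSpace E]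

lemma core_local {F : (R × K) × ℝ → E} (π : E →L[ℝ] R) (hW : ∃ w, π w = 0 ∧ w ≠ 0)
    {s0 : R × K} {ε : ℝ} (hε : 0 < ε)
    (hF : AnalyticOnNhd ℝ F (Metric.ball (s0, (0:ℝ)) ε))
    (hπ : ∀ y ∈ Metric.ball (s0, (0:ℝ)) ε, π (F y) = y.1.1)
    (hz : ∀ y ∈ Metric.ball (s0, (0:ℝ)) ε, y.2 = 0 → ∀ ζ : K, fderiv ℝ F y ((0, ζ), 0) = 0)
    (hopen : ∀ V ⊆ Metric.ball (s0, (0:ℝ)) ε, IsOpen V → IsOpen (F '' V)) :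
    ∃ y1 ∈ Metric.ball (s0, (0:ℝ)) ε, y1.2 = 0 ∧ ∃ (w0 : E) (ν : E →L[ℝ] ℝ),
      π w0 = 0 ∧ ν w0 = 1 ∧ (∀ e, π e = 0 → e = ν e • w0) ∧
      ∀ c : ℝ, c ≠ 0 → ¬ ∀ᶠ y in 𝓝 y1, (0 < y.2 → 0 ≤ c * ν (fderiv ℝ F y (0, 1))) ∧
        (y.2 < 0 → c * ν (fderiv ℝ F y (0, 1)) ≤ 0) := by
  set B := Metric.ball (s0, (0:ℝ)) ε with hB
  -- the slice t = 0
  have hmem : ∀ y : (R × K) × ℝ, y ∈ B ↔ (y.1.1 ∈ Metric.ball s0.1 ε ∧ y.1.2 ∈ Metric.ball s0.2 ε) ∧ |y.2| < ε := by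
    intro y
    rw [hB, mem_ball_prod, ← Prod.mk.eta (p := s0), ← ball_prod_same, Set.mem_prod]
  let c0 : (R × K) × ℝ → (R × K) × ℝ := fun y => ((y.1.1, s0.2), 0)
  have hc0 : ∀ y ∈ B, c0 y ∈ B := by
    intro y hy
    rw [hmem] at hy ⊢
    exact ⟨⟨hy.1.1, Metric.mem_ball_self hε⟩, by simpa [c0] using hε⟩
  have hconst : ∀ y ∈ B, y.2 = 0 → F y = F (c0 y) := by
    rintro ⟨⟨x, z⟩, t⟩ hy ht
    simp only at ht
    subst ht
    have hy' := (hmem _).1 hy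
    simp only at hy'
    have hin : ∀ ζ ∈ Metric.ball s0.2 ε, ((x, ζ), (0:ℝ)) ∈ B := fun ζ hζ =>
      (hmem _).2 ⟨⟨hy'.1.1, hζ⟩, hy'.2⟩
    have hd : ∀ ζ ∈ Metric.ball s0.2 ε, HasFDerivAt (fun ζ => F ((x, ζ), (0:ℝ))) (0 : K →L[ℝ] E) ζ := by
      intro ζ hζ
      have h1 : HasFDerivAt (fun ζ : K => ((x, ζ), (0:ℝ)))
        (((0 : K →L[ℝ] R).prod (ContinuousLinearMap.id ℝ K)).prod (0 : K →L[ℝ] ℝ)) ζ :=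
        ((hasFDerivAt_const x ζ).prodMk (hasFDerivAt_id ζ)).prodMk (hasFDerivAt_const 0 ζ)
      have h2 := ((hF _ (hin ζ hζ)).differentiableAt.hasFDerivAt).comp ζ h1
      refine h2.congr_fderiv ?_
      ext v
      simpa using hz _ (hin ζ hζ) rfl v
    exact (convex_ball s0.2 ε).is_const_of_fderivWithin_eq_zero (𝕜 := ℝ)
      (fun ζ hζ => (hd ζ hζ).differentiableAt.differentiableWithinAt)
      (fun ζ hζ => by rw [fderivWithin_of_isOpen Metric.isOpen_ball hζ]; exact (hd ζ hζ).fderiv)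
      hy'.1.2 (Metric.mem_ball_self hε)
  let b : (R × K) × ℝ → E := fun y => F y - F (c0 y)
  have hc0an : ∀ y, AnalyticAt ℝ c0 y := by
    intro y
    refine AnalyticAt.prod (AnalyticAt.prod ?_ analyticAt_const) analyticAt_const
    exact analyticAt_fst.comp analyticAt_fst
  have hban : AnalyticOnNhd ℝ b B := by
    intro y hy
    exact (hF y hy).sub ((hF _ (hc0 y hy)).comp (hc0an y))
  have hb0 : ∀ y ∈ B, y.2 = 0 → b y = 0 := fun y hy h => sub_eq_zero.2 (hconst y hy h)
  have hπb : ∀ y ∈ B, π (b y) = 0 := by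
    intro y hy
    simp only [b, map_sub, hπ y hy, hπ _ (hc0 y hy), c0, sub_self]
  have miss : ∀ V ⊆ B, IsOpen V → ∀ y1 ∈ V, y1.2 = 0 → ∀ w, π w = 0 →
      ∃ c : ℝ, 0 < c ∧ ∃ y ∈ V, b y = c • w := by
    intro V hVB hV y1 hy1 ht w hw
    have hn : F '' V ∈ 𝓝 (F y1) := (hopen V hVB hV).mem_nhds (mem_image_of_mem F hy1)
    have hcont : Tendsto (fun c : ℝ => F y1 + c • w) (𝓝[>] 0) (𝓝 (F y1)) := by
      have : Continuous (fun c : ℝ => F y1 + c • w) := by fun_prop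
      have := this.tendsto 0
      simp only [zero_smul, add_zero] at this
      exact this.mono_left nhdsWithin_le_nhds
    obtain ⟨c, ⟨y, hy, hyc⟩, hc⟩ := ((hcont.eventually hn).and self_mem_nhdsWithin).exists
    refine ⟨c, hc, y, hy, ?_⟩
    have h1 : y.1.1 = y1.1.1 := by
      rw [← hπ y (hVB hy), ← hπ y1 (hVB hy1), hyc]
      simp [hw]
    have h2 : c0 y = c0 y1 := by simp [c0, h1]
    simp only [b, h2, hyc, hconst y1 (hVB hy1) ht]
    abel
  obtain ⟨w, hw, hwne⟩ := hW
  rcases order_dichotomy hban with h0 | ⟨s1, μ, δ, hδ, hsub, hμ⟩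
  · exfalso
    obtain ⟨c, hc, y, hy, hyc⟩ := miss B le_rfl Metric.isOpen_ball (s0, 0) (Metric.mem_ball_self hε) rfl w hw
    rw [h0 y hy] at hyc
    exact (smul_ne_zero hc.ne' hwne) hyc.symm
  have hmu : ∀ w, π w = 0 → μ w = 0 → w = 0 := by
    intro w hw hμw
    by_contra hwne
    obtain ⟨c, hc, y, hy, hyc⟩ := miss _ hsub Metric.isOpen_ball (s1, 0) (Metric.mem_ball_self hδ) rfl w hw
    by_cases hy2 : y.2 = 0
    · rw [hb0 y (hsub hy) hy2] at hyc
      exact (smul_ne_zero hc.ne' hwne) hyc.symm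
    · apply hμ y hy hy2
      rw [hyc, map_smul, hμw, smul_zero]
  have hμw : μ w ≠ 0 := fun h => hwne (hmu w hw h)
  refine ⟨(s1, 0), hsub (Metric.mem_ball_self hδ), rfl, (μ w)⁻¹ • w, μ, by simp [hw], by simp [hμw], ?_, ?_⟩
  · intro e he
    refine sub_eq_zero.1 (hmu _ (by simp [he, hw]) ?_)
    simp [hμw]
  · intro c hc hev
    obtain ⟨δ', hδ', hball⟩ := Metric.eventually_nhds_iff_ball.1
      (hev.and (Metric.isOpen_ball.eventually_mem (hsub (Metric.mem_ball_self hδ))))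
    obtain ⟨k, hk, y, hy, hyc⟩ := miss (Metric.ball (s1, 0) δ') (fun y hy => (hball y hy).2)
      Metric.isOpen_ball (s1, 0) (Metric.mem_ball_self hδ') rfl ((-c * (μ w)⁻¹) • w) (by simp [hw])
    have hneg : c * μ (b y) < 0 := by
      rw [hyc]
      have : c * μ (k • (-c * (μ w)⁻¹) • w) = - (k * c ^ 2) := by
        simp only [map_smul, smul_eq_mul]; field_simp
      rw [this]
      have : 0 < c ^ 2 := by positivity
      nlinarith [mul_pos hk this]
    obtain ⟨s, t⟩ := y
    have hm := mem_ball_prod.1 hy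
    simp only at hm
    have hin : ∀ τ : ℝ, |τ| ≤ |t| → (s, τ) ∈ Metric.ball (s1, (0:ℝ)) δ' := fun τ hτ =>
      mem_ball_prod.2 ⟨hm.1, hτ.trans_lt hm.2⟩
    have hder : ∀ τ : ℝ, |τ| ≤ |t| → HasDerivAt (fun τ => c * μ (b (s, τ))) 
        (c * μ (fderiv ℝ F (s, τ) (0, 1))) τ := by
      intro τ hτ
      have h1 : HasDerivAt (fun t : ℝ => (s, t)) (0, 1) τ :=
        (hasDerivAt_const τ s).prodMk (hasDerivAt_id τ)
      have h2 := ((hF _ (hball _ (hin τ hτ)).2).differentiableAt.hasFDerivAt).comp_hasDerivAt τ h1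
      have h3 := h2.sub_const (F ((s.1, s0.2), 0))
      have h4 := (μ.hasFDerivAt.comp_hasDerivAt τ h3).const_mul c
      exact h4
    have hb00 : c * μ (b (s, 0)) = 0 := by
      rw [hb0 (s, 0) (hball _ (hin 0 (by simp))).2 rfl]; simp
    rcases le_total 0 t with ht | ht
    · have : MonotoneOn (fun τ => c * μ (b (s, τ))) (Icc 0 t) := by
        have habs : ∀ τ ∈ Icc 0 t, |τ| ≤ |t| := fun τ hτ => abs_le_abs_of_nonneg hτ.1 hτ.2
        apply monotoneOn_of_deriv_nonneg (convex_Icc 0 t)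
        · intro τ hτ
          exact (hder τ (habs τ hτ)).continuousAt.continuousWithinAt
        · intro τ hτ
          exact (hder τ (habs τ (interior_subset hτ))).differentiableAt.differentiableWithinAt
        · intro τ hτ
          rw [(hder τ (habs τ (interior_subset hτ))).deriv]
          rw [interior_Icc] at hτ
          exact (hball _ (hin τ (habs τ (Ioo_subset_Icc_self hτ)))).1.1 hτ.1
      have := this (left_mem_Icc.2 ht) (right_mem_Icc.2 ht) ht
      simp only at this
      linarith
    · have : AntitoneOn (fun τ => c * μ (b (s, τ))) (Icc t 0) := by
        have habs : ∀ τ ∈ Icc t 0, |τ| ≤ |t| := fun τ hτ => abs_le_abs_of_nonpos hτ.2 hτ.1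
        apply antitoneOn_of_deriv_nonpos (convex_Icc t 0)
        · intro τ hτ
          exact (hder τ (habs τ hτ)).continuousAt.continuousWithinAt
        · intro τ hτ
          exact (hder τ (habs τ (interior_subset hτ))).differentiableAt.differentiableWithinAt
        · intro τ hτ
          rw [(hder τ (habs τ (interior_subset hτ))).deriv]
          rw [interior_Icc] at hτ
          exact (hball _ (hin τ (habs τ (Ioo_subset_Icc_self hτ)))).1.2 hτ.2
      have := this (left_mem_Icc.2 ht) (right_mem_Icc.2 ht) ht
      simp only at this
      linarith
end
section
variable {E : Type*} [NormedAddCommGroup E] [NormedSpace ℝ E] [FiniteDimensional ℝ E]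

lemma no_side {f : E → E} (hf : ∀ x, AnalyticAt ℝ f x) (hopen : IsOpenMap f)
    {g : E → ℝ} (hg : ∀ x, AnalyticAt ℝ g x) {p : E} (hgp : g p = 0) (hdg : fderiv ℝ g p ≠ 0)
    (hside : ∀ᶠ x in 𝓝 p, (0 < g x → 0 ≤ (fderiv ℝ f x).det) ∧
      (g x < 0 → (fderiv ℝ f x).det ≤ 0)) : False := by
  have : CompleteSpace E := FiniteDimensional.complete ℝ E
  have hreg : ∀ᶠ x in 𝓝 p, fderiv ℝ g x ≠ 0 := (hg p).fderiv.continuousAt.eventually_ne hdg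
  obtain ⟨U, hU, hUo, hpU⟩ := eventually_nhds_iff.1 (hside.and hreg)
  let Im : E → Submodule ℝ E := fun x =>
    (LinearMap.ker (fderiv ℝ g x : E →ₗ[ℝ] ℝ)).map (fderiv ℝ f x : E →ₗ[ℝ] E)
  -- a point of maximal rank
  obtain ⟨q, hqU, hgq, hmax⟩ : ∃ q ∈ U, g q = 0 ∧ ∀ x ∈ U, g x = 0 →
      Module.finrank ℝ (Im x) ≤ Module.finrank ℝ (Im q) := by
    have hex : ∃ k, ∃ q ∈ U, g q = 0 ∧ Module.finrank ℝ E - Module.finrank ℝ (Im q) = k :=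
      ⟨_, p, hpU, hgp, rfl⟩
    classical
    obtain ⟨q, hqU, hgq, hk⟩ := Nat.find_spec hex
    refine ⟨q, hqU, hgq, fun x hx hgx => ?_⟩
    have h1 := Nat.find_min' hex ⟨x, hx, hgx, rfl⟩
    have h2 := Submodule.finrank_le (Im x)
    have h3 := Submodule.finrank_le (Im q)
    omega
  have hdgq : fderiv ℝ g q ≠ 0 := (hU q hqU).2
  let R : Submodule ℝ E := Im q
  let K : Submodule ℝ E := LinearMap.ker (fderiv ℝ g q : E →ₗ[ℝ] ℝ) ⊓
    LinearMap.ker (fderiv ℝ f q : E →ₗ[ℝ] E)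
  obtain ⟨π, hπ⟩ : R.ClosedComplemented := Submodule.ClosedComplemented.of_finiteDimensional R
  obtain ⟨ρ, hρ⟩ : K.ClosedComplemented := Submodule.ClosedComplemented.of_finiteDimensional K
  let G : E → (R × K) × ℝ := fun x => ((π (f x), ρ x), g x)
  let G' : E → E →L[ℝ] (R × K) × ℝ := fun x =>
    ((π.comp (fderiv ℝ f x)).prod ρ).prod (fderiv ℝ g x)
  have hGan : ∀ x, AnalyticAt ℝ G x := fun x =>
    (((π.analyticAt _).comp (hf x)).prod (ρ.analyticAt x)).prod (hg x)
  have hG' : ∀ x, HasFDerivAt G (G' x) x := fun x =>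
    ((π.hasFDerivAt.comp x (hf x).differentiableAt.hasFDerivAt).prodMk ρ.hasFDerivAt).prodMk
      (hg x).differentiableAt.hasFDerivAt
  have hinj : Function.Injective (G' q) := by
    rw [injective_iff_map_eq_zero]
    intro v hv
    have h1 : π (fderiv ℝ f q v) = 0 := congrArg (fun y => y.1.1) hv
    have h2 : ρ v = 0 := congrArg (fun y => y.1.2) hv
    have h3 : fderiv ℝ g q v = 0 := congrArg (fun y => y.2) hv
    have h4 : fderiv ℝ f q v ∈ R := ⟨v, h3, rfl⟩
    have h5 := hπ ⟨_, h4⟩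
    have h6 : fderiv ℝ f q v = 0 := by
      have := h5.symm.trans h1
      exact congrArg Subtype.val this
    have h7 := (hρ ⟨v, h3, h6⟩).symm.trans h2
    exact congrArg Subtype.val h7
  have hsurj : Function.Surjective (G' q) := by
    rintro ⟨⟨ξ, ζ⟩, τ⟩
    obtain ⟨u, hu⟩ : ∃ u, fderiv ℝ g q u = τ := by
      have : Function.Surjective (fderiv ℝ g q : E →ₗ[ℝ] ℝ) := by
        apply LinearMap.surjective
        intro h
        exact hdgq (by ext v; exact congrArg (fun l => l v) h)
      exact this τ
    obtain ⟨w, hw, hw'⟩ := (ξ - π (fderiv ℝ f q u)).2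
    have hw : fderiv ℝ g q w = 0 := hw
    have hw' : fderiv ℝ f q w = _ := hw'
    have hk1 : fderiv ℝ g q (ζ - ρ (u + w) : K) = 0 := (ζ - ρ (u + w)).2.1
    have hk2 : fderiv ℝ f q (ζ - ρ (u + w) : K) = 0 := (ζ - ρ (u + w)).2.2
    refine ⟨u + w + (ζ - ρ (u + w) : K), ?_⟩
    refine Prod.ext (Prod.ext ?_ ?_) ?_
    · change π (fderiv ℝ f q (u + w + (ζ - ρ (u + w) : K))) = ξ
      rw [(fderiv ℝ f q).map_add, (fderiv ℝ f q).map_add, hk2, hw', add_zero, map_add, hπ]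
      abel
    · change ρ (u + w + (ζ - ρ (u + w) : K)) = ζ
      rw [map_add, hρ]
      abel
    · change fderiv ℝ g q (u + w + (ζ - ρ (u + w) : K)) = τ
      rw [map_add, map_add, hk1, hw, hu]
      simp
  let L : E ≃L[ℝ] (R × K) × ℝ := ContinuousLinearEquiv.ofBijective (G' q)
    (LinearMap.ker_eq_bot.2 hinj) (LinearMap.range_eq_top.2 hsurj)
  have hL : (L : E →L[ℝ] (R × K) × ℝ) = G' q := ContinuousLinearEquiv.coe_ofBijective _ _ _
  have hfr : Module.finrank ℝ E = Module.finrank ℝ ((R × K) × ℝ) := L.toLinearEquiv.finrank_eq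
  have hst : HasStrictFDerivAt G (L : E →L[ℝ] (R × K) × ℝ) q := by
    rw [hL, ← (hG' q).fderiv]
    exact (hGan q).hasStrictFDerivAt
  let e := hst.toOpenPartialHomeomorph G
  have heG : ∀ x, e x = G x := fun x => rfl
  have hqe : q ∈ e.source := hst.mem_toOpenPartialHomeomorph_source
  have hsymm : AnalyticAt ℝ e.symm (e q) :=
    e.analyticAt_symm' hqe (hGan q) (by rw [hL]; exact (hG' q).fderiv)
  let s0 : R × K := (π (f q), ρ q)
  have heq : e q = (s0, 0) := by
    rw [heG]; simp [G, s0, hgq]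
  have hev : ∀ᶠ y in 𝓝 (s0, (0:ℝ)), AnalyticAt ℝ e.symm y ∧ y ∈ e.target ∧ e.symm y ∈ U := by
    rw [← heq]
    refine hsymm.eventually_analyticAt.and
      ((e.open_target.eventually_mem (e.map_source hqe)).and ?_)
    apply hsymm.continuousAt.eventually_mem
    rw [e.left_inv hqe]
    exact hUo.mem_nhds hqU
  obtain ⟨ε, hε, hball⟩ := Metric.eventually_nhds_iff_ball.1 hev
  set B := Metric.ball (s0, (0:ℝ)) ε with hB
  have hGs : ∀ y ∈ B, G (e.symm y) = y := fun y hy => e.right_inv (hball y hy).2.1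
  let F : (R × K) × ℝ → E := fun y => f (e.symm y)
  let Φ := fun y => fderiv ℝ e.symm y
  have hΦ : ∀ y ∈ B, HasFDerivAt e.symm (Φ y) y := fun y hy =>
    (hball y hy).1.differentiableAt.hasFDerivAt
  have hGΦ : ∀ y ∈ B, ∀ v, G' (e.symm y) (Φ y v) = v := by
    intro y hy v
    have h1 := (hG' (e.symm y)).comp y (hΦ y hy)
    have h2 : (G ∘ e.symm) =ᶠ[𝓝 y] id := by
      filter_upwards [Metric.isOpen_ball.mem_nhds hy] with z hz using hGs z hz
    have h3 := (h1.congr_of_eventuallyEq h2.symm).unique (hasFDerivAt_id y)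
    exact congrArg (fun l => l v) h3
  have hF' : ∀ y ∈ B, fderiv ℝ F y = (fderiv ℝ f (e.symm y)).comp (Φ y) := fun y hy =>
    ((hf _).differentiableAt.hasFDerivAt.comp y (hΦ y hy)).fderiv
  have hFan : AnalyticOnNhd ℝ F B := fun y hy => (hf _).comp (hball y hy).1
  have hπF : ∀ y ∈ B, π (F y) = y.1.1 := fun y hy => congrArg (fun y => y.1.1) (hGs y hy)
  have hgs : ∀ y ∈ B, g (e.symm y) = y.2 := fun y hy => congrArg (fun y => y.2) (hGs y hy)
  have hπF' : ∀ y ∈ B, ∀ v, π (fderiv ℝ F y v) = v.1.1 := by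
    intro y hy v
    rw [hF' y hy]
    exact congrArg (fun y => y.1.1) (hGΦ y hy v)
  have hgΦ : ∀ y ∈ B, ∀ v, fderiv ℝ g (e.symm y) (Φ y v) = v.2 := fun y hy v =>
    congrArg (fun y => y.2) (hGΦ y hy v)
  have hz : ∀ y ∈ B, y.2 = 0 → ∀ ζ : K, fderiv ℝ F y ((0, ζ), 0) = 0 := by
    intro y hy hy2 ζ
    set N := Im (e.symm y) with hN
    have hmem : ∀ v : (R × K) × ℝ, v.2 = 0 → fderiv ℝ F y v ∈ N := by
      intro v hv
      rw [hF' y hy]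
      exact ⟨Φ y v, by simpa [hv] using hgΦ y hy v, rfl⟩
    have hrank : Module.finrank ℝ N ≤ Module.finrank ℝ R :=
      hmax _ (hball y hy).2.2 (by rw [hgs y hy, hy2])
    let πN : N →ₗ[ℝ] R := (π : E →ₗ[ℝ] R).comp N.subtype
    have hs : Function.Surjective πN := by
      intro ξ
      exact ⟨⟨_, hmem ((ξ, 0), 0) rfl⟩, hπF' y hy _⟩
    have hr2 : Module.finrank ℝ N = Module.finrank ℝ R :=
      le_antisymm hrank (LinearMap.finrank_le_finrank_of_surjective hs)
    have hi : Function.Injective πN :=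
      (LinearMap.injective_iff_surjective_of_finrank_eq_finrank hr2).2 hs
    have h0 : (⟨_, hmem ((0, ζ), 0) rfl⟩ : N) = 0 := by
      apply hi
      rw [map_zero]
      exact hπF' y hy _
    exact congrArg Subtype.val h0
  have hop : ∀ V ⊆ B, IsOpen V → IsOpen (F '' V) := by
    intro V hV hVo
    have h1 : IsOpen (e.symm '' V) := e.symm.isOpen_image_of_subset_source hVo
      (fun y hy => (hball y (hV hy)).2.1)
    have h2 := hopen _ h1
    rwa [image_image] at h2
  have hW : ∃ w, π w = 0 ∧ w ≠ 0 := by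
    by_contra hcon
    push Not at hcon
    have hi : Function.Injective (π : E →ₗ[ℝ] R) := by
      rw [injective_iff_map_eq_zero]; exact hcon
    have h1 := LinearMap.finrank_le_finrank_of_injective hi
    rw [hfr, Module.finrank_prod, Module.finrank_prod, Module.finrank_self] at h1
    omega
  obtain ⟨y1, hy1, hy12, w0, ν, hw0, hνw0, hspan, hno⟩ :=
    core_local π hW hε hFan hπF hz hop
  -- the one-dimensional kernel case
  let ι : (R × K) × ℝ →L[ℝ] E :=
    (R.subtypeL.comp ((ContinuousLinearMap.fst ℝ R K).comp (ContinuousLinearMap.fst ℝ (R × K) ℝ)))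
      + (ContinuousLinearMap.snd ℝ (R × K) ℝ).smulRight w0
  have hι : ∀ v, ι v = (v.1.1 : E) + v.2 • w0 := fun v => rfl
  let ν' : E →L[ℝ] ℝ := ν.comp (ContinuousLinearMap.id ℝ E - R.subtypeL.comp π)
  have hν' : ∀ v, ν' v = ν (v - (π v : E)) := fun v => rfl
  have hdec : ∀ v : E, v = (π v : E) + ν' v • w0 := by
    intro v
    have := hspan (v - (π v : E)) (by rw [map_sub, hπ, sub_self])
    rw [hν', ← this]
    abel
  have hιs : Function.Surjective (ι : (R × K) × ℝ →ₗ[ℝ] E) := fun v =>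
    ⟨((π v, 0), ν' v), (hdec v).symm⟩
  have hιi : Function.Injective (ι : (R × K) × ℝ →ₗ[ℝ] E) :=
    (LinearMap.injective_iff_surjective_of_finrank_eq_finrank hfr.symm).2 hιs
  have hK0 : ∀ ζ : K, ζ = 0 := by
    intro ζ
    have h1 : ((0, ζ), (0:ℝ)) = (0 : (R × K) × ℝ) := by
      apply hιi
      change ι _ = ι _
      rw [hι, map_zero]
      simp
    exact congrArg (fun y => y.1.2) h1
  let C : E → E →L[ℝ] E := fun x => ι.comp (G' x)
  have hν'w0 : ν' w0 = 1 := by rw [hν', hw0]; simpa using hνw0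
  have hdet : ∀ y ∈ B, (fderiv ℝ f (e.symm y)).det =
      (C (e.symm y)).det * ν (fderiv ℝ F y (0, 1)) := by
    intro y hy
    have hbij : Function.Bijective (Φ y : (R × K) × ℝ →ₗ[ℝ] E) := by
      have hi : Function.Injective (Φ y : (R × K) × ℝ →ₗ[ℝ] E) :=
        Function.LeftInverse.injective (g := G' (e.symm y)) (hGΦ y hy)
      exact ⟨hi, (LinearMap.injective_iff_surjective_of_finrank_eq_finrank hfr.symm).1 hi⟩
    have hΦG : ∀ v, Φ y (G' (e.symm y) v) = v := by
      intro v
      obtain ⟨u, rfl⟩ := hbij.2 v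
      exact congrArg (Φ y) (hGΦ y hy u)
    let T : E →ₗ[ℝ] E := LinearMap.transvection
      ((ν' : E →ₗ[ℝ] ℝ).comp ((fderiv ℝ F y : (R × K) × ℝ →ₗ[ℝ] E).comp
        (((π : E →ₗ[ℝ] R).prod 0).prod (ν' : E →ₗ[ℝ] ℝ))) - (ν' : E →ₗ[ℝ] ℝ)) w0
    have hT : ∀ v, T v = fderiv ℝ F y ((π v, 0), ν' v) := by
      intro v
      have h1 : T v = v + (ν' (fderiv ℝ F y ((π v, 0), ν' v)) - ν' v) • w0 := rfl
      have h2 := hdec (fderiv ℝ F y ((π v, 0), ν' v))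
      rw [hπF' y hy] at h2
      have h3 := hdec v
      have h4 : (π v : E) = v - ν' v • w0 := by
        rw [eq_sub_iff_add_eq]; exact h3.symm
      rw [h1, sub_smul]
      refine Eq.trans ?_ h2.symm
      simp only [h4]
      abel
    have hcomp : (fderiv ℝ f (e.symm y) : E →ₗ[ℝ] E) = T.comp (C (e.symm y) : E →ₗ[ℝ] E) := by
      ext v
      have h1 : T (C (e.symm y) v) = fderiv ℝ F y (G' (e.symm y) v) := by
        rw [hT]
        congr 1
        apply hιi
        change ι ((π (C (e.symm y) v), 0), ν' (C (e.symm y) v)) = ι (G' (e.symm y) v)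
        exact (hdec (C (e.symm y) v)).symm
      change fderiv ℝ f (e.symm y) v = T (C (e.symm y) v)
      rw [h1, hF' y hy]
      change _ = fderiv ℝ f (e.symm y) (Φ y (G' (e.symm y) v))
      rw [hΦG]
    have hTd : LinearMap.det T = ν (fderiv ℝ F y (0, 1)) := by
      rw [LinearMap.transvection.det]
      change 1 + (ν' (fderiv ℝ F y ((π w0, 0), ν' w0)) - ν' w0) = _
      rw [hν'w0, hw0, hν', hπF' y hy]
      simp
      rfl
    change LinearMap.det (fderiv ℝ f (e.symm y) : E →ₗ[ℝ] E) =
      LinearMap.det (C (e.symm y) : E →ₗ[ℝ] E) * _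
    rw [hcomp, LinearMap.det_comp, hTd, mul_comm]
  have hC0 : (C (e.symm y1)).det ≠ 0 := by
    have hs : Function.Surjective (G' (e.symm y1) : E →ₗ[ℝ] (R × K) × ℝ) := fun v =>
      ⟨Φ y1 v, hGΦ y1 hy1 v⟩
    have hi := (LinearMap.injective_iff_surjective_of_finrank_eq_finrank hfr).2 hs
    have hCi : Function.Injective (C (e.symm y1) : E →ₗ[ℝ] E) := hιi.comp hi
    have := LinearMap.isUnit_iff_ker_eq_bot (C (e.symm y1) : E →ₗ[ℝ] E) |>.2
      (LinearMap.ker_eq_bot.2 hCi)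
    exact (LinearMap.isUnit_iff_isUnit_det _ |>.1 this).ne_zero
  have hCc : ContinuousAt (fun y => (C (e.symm y)).det) y1 := by
    have h1 : ContinuousAt C (e.symm y1) := by
      have hcf : ContinuousAt (fderiv ℝ f) (e.symm y1) := (hf _).fderiv.continuousAt
      have hcg : ContinuousAt (fderiv ℝ g) (e.symm y1) := (hg _).fderiv.continuousAt
      have : ContinuousAt G' (e.symm y1) := by
        have := (hGan (e.symm y1)).fderiv.continuousAt
        refine this.congr (Eventually.of_forall fun x => (hG' x).fderiv)
      exact continuousAt_const.clm_comp this
    exact ContinuousLinearMap.continuous_det.continuousAt.comp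
      (ContinuousAt.comp h1 (hball y1 hy1).1.continuousAt)
  apply hno _ hC0
  have hpos : ∀ᶠ y in 𝓝 y1, 0 < (C (e.symm y)).det * (C (e.symm y1)).det :=
    (hCc.mul continuousAt_const).eventually (lt_mem_nhds (mul_self_pos.2 hC0))
  filter_upwards [hpos, Metric.isOpen_ball.mem_nhds hy1] with y hy hyB
  have hs := (hU _ (hball y hyB).2.2).1
  rw [hgs y hyB, hdet y hyB] at hs
  generalize (C (e.symm y)).det = d at hs hy
  generalize (C (e.symm y1)).det = d1 at hs hy
  generalize ν (fderiv ℝ F y (0, 1)) = h at hs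
  have hd2 : 0 < d ^ 2 := by
    have : d ≠ 0 := by rintro rfl; simp at hy
    positivity
  refine ⟨fun ht => ?_, fun ht => ?_⟩
  · have := mul_nonneg (hs.1 ht) hy.le
    have h3 : d * h * (d * d1) = d ^ 2 * (d1 * h) := by ring
    rw [h3] at this
    exact nonneg_of_mul_nonneg_right this hd2
  · have := mul_nonpos_of_nonpos_of_nonneg (hs.2 ht) hy.le
    have h3 : d * h * (d * d1) = d ^ 2 * (d1 * h) := by ring
    rw [h3] at this
    exact nonpos_of_mul_nonpos_right this hd2
end

/-- **Theorem A (Hirsch).** The Jacobian of a real analytic open map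
`f : ℝⁿ → ℝⁿ` does not change sign. -/
theorem jacobian_of_analytic_open_map_does_not_change_sign
    {n : ℕ} (hn : 0 < n)
    (f : EuclideanSpace ℝ (Fin n) → EuclideanSpace ℝ (Fin n))
    (hf : ∀ p, AnalyticAt ℝ f p) (hopen : IsOpenMap f) :
    (∀ p, 0 ≤ (fderiv ℝ f p).det) ∨ (∀ p, (fderiv ℝ f p).det ≤ 0) := by
  by_contra hcon
  push Not at hcon
  obtain ⟨⟨b, hb⟩, ⟨a, ha⟩⟩ := hcon
  have hJ : ∀ x, AnalyticAt ℝ (fun x => (fderiv ℝ f x).det) x := by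
    intro x
    have hd := (hf x).fderiv
    let bs := (EuclideanSpace.basisFun (Fin n) ℝ).toBasis
    have h1 : (fun x => (fderiv ℝ f x).det) =
        fun x => (LinearMap.toMatrix bs bs (fderiv ℝ f x : EuclideanSpace ℝ (Fin n) →ₗ[ℝ] _)).det := by
      ext x
      exact (LinearMap.det_toMatrix bs _).symm
    rw [h1]
    simp only [Matrix.det_apply]
    apply Finset.analyticAt_fun_sum
    intro σ _
    have hprod : AnalyticAt ℝ (fun x => ∏ i, LinearMap.toMatrix bs bs
        (fderiv ℝ f x : EuclideanSpace ℝ (Fin n) →ₗ[ℝ] _) (σ i) i) x := by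
      apply Finset.analyticAt_fun_prod
      intro i _
      simp only [LinearMap.toMatrix_apply]
      let ev : (EuclideanSpace ℝ (Fin n) →L[ℝ] EuclideanSpace ℝ (Fin n)) →L[ℝ] ℝ :=
        (EuclideanSpace.proj (σ i)).comp (ContinuousLinearMap.apply ℝ _ (bs i))
      exact (ev.analyticAt _).comp hd
    rcases Int.units_eq_one_or (Equiv.Perm.sign σ) with h | h
    · simpa [h] using hprod
    · have h2 := hprod.neg
      simp only [h, Units.neg_smul, one_smul]
      exact h2
  obtain ⟨p, g, hg, hgp, hdg, hside⟩ := exists_side hJ ha hb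
  exact no_side hf hopen hg hgp hdg hside
end

section
/- Let f : ℝ² → ℝ² be a real analytic open map. Then the branch set B of f — the set of points at which f is not a local homeomorphism — is a closed and discrete subset of ℝ². -/
open Set Filter Topology

lemma open_hits {φ : ℝ × ℝ → ℝ × ℝ} (ho : IsOpenMap φ) (z : ℝ × ℝ) {P : ℝ × ℝ → Prop}
    (hP : ∀ᶠ w in 𝓝 z, P w) (σ : ℝ) :
    ∃ δ : ℝ, 0 < δ ∧ ∃ w, P w ∧ φ w = ((φ z).1, (φ z).2 + σ * δ) := by
  have h1 : ∀ᶠ y in 𝓝 (φ z), ∃ w, P w ∧ φ w = y := by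
    have : φ '' {w | P w} ∈ 𝓝 (φ z) := ho.image_mem_nhds hP
    filter_upwards [this] with y hy
    exact hy
  have h2 : Tendsto (fun δ : ℝ => ((φ z).1, (φ z).2 + σ * δ)) (𝓝[>] 0) (𝓝 (φ z)) := by
    have : Continuous (fun δ : ℝ => ((φ z).1, (φ z).2 + σ * δ)) := by fun_prop
    have := this.tendsto 0
    simp only [mul_zero, add_zero, Prod.mk.eta] at this
    exact this.mono_left nhdsWithin_le_nhds
  have h3 := (h2.eventually h1).and (self_mem_nhdsWithin : ∀ᶠ δ in 𝓝[>] (0 : ℝ), δ ∈ Ioi (0:ℝ))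
  obtain ⟨δ, hδ, hδ0⟩ := h3.exists
  exact ⟨δ, hδ0, hδ⟩

lemma exists_clequiv (L : (ℝ × ℝ) →L[ℝ] (ℝ × ℝ)) (hL : ∀ z, L z = 0 → z = 0) :
    ∃ e : (ℝ × ℝ) ≃L[ℝ] (ℝ × ℝ), (e : (ℝ × ℝ) →L[ℝ] (ℝ × ℝ)) = L := by
  have inj : Function.Injective (L : (ℝ × ℝ) →ₗ[ℝ] (ℝ × ℝ)) := by
    rw [← LinearMap.ker_eq_bot, LinearMap.ker_eq_bot']
    exact hL
  refine ⟨(LinearEquiv.ofInjectiveEndo _ inj).toContinuousLinearEquiv, ?_⟩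
  ext <;> simp

lemma rank_one {φ : ℝ × ℝ → ℝ × ℝ} (hφ : Continuous φ) (ho : IsOpenMap φ) (q : ℝ × ℝ)
    (A : (ℝ × ℝ) →L[ℝ] ℝ) (hA : HasStrictFDerivAt (fun z => (φ z).1) A q) (hne : A ≠ 0) :
    ∃ N : Set (ℝ × ℝ), IsOpen N ∧ q ∈ N ∧ InjOn φ N := by
  set a := A (1, 0) with ha
  set b := A (0, 1) with hb
  have hAz : ∀ z : ℝ × ℝ, A z = a * z.1 + b * z.2 := by
    intro z
    have : z = z.1 • ((1 : ℝ), (0 : ℝ)) + z.2 • ((0 : ℝ), (1 : ℝ)) := by ext <;> simp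
    conv_lhs => rw [this]
    rw [map_add, map_smul, map_smul]
    simp only [smul_eq_mul, ← ha, ← hb]; ring
  have hab : 0 < a ^ 2 + b ^ 2 := by
    rcases eq_or_ne a 0 with h | h
    · rcases eq_or_ne b 0 with h' | h'
      · exfalso; apply hne; ext <;> simp [hAz, h, h']
      · positivity
    · positivity
  let m : (ℝ × ℝ) →L[ℝ] ℝ := (-b) • ContinuousLinearMap.fst ℝ ℝ ℝ + a • ContinuousLinearMap.snd ℝ ℝ ℝ
  obtain ⟨e, he⟩ := exists_clequiv (A.prod m) (by
    intro z hz
    have h1 : a * z.1 + b * z.2 = 0 := by rw [← hAz]; exact congrArg Prod.fst hz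
    have h2 : -b * z.1 + a * z.2 = 0 := by
      have := congrArg Prod.snd hz
      simpa [m] using this
    have h3 : (a ^ 2 + b ^ 2) * z.1 = 0 := by linear_combination a * h1 - b * h2
    have h4 : (a ^ 2 + b ^ 2) * z.2 = 0 := by linear_combination b * h1 + a * h2
    ext
    · simpa using (mul_eq_zero.1 h3).resolve_left hab.ne'
    · simpa using (mul_eq_zero.1 h4).resolve_left hab.ne')
  let Ψ : ℝ × ℝ → ℝ × ℝ := fun z => ((φ z).1, m z)
  have hΨ : HasStrictFDerivAt Ψ (e : (ℝ × ℝ) →L[ℝ] (ℝ × ℝ)) q := by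
    rw [he]; exact hA.prodMk m.hasStrictFDerivAt
  set H := hΨ.toOpenPartialHomeomorph Ψ with hH
  have hHc : ∀ z, H z = Ψ z := fun z => rfl
  have hΨc : Continuous Ψ := by fun_prop
  have hqs : q ∈ H.source := hΨ.mem_toOpenPartialHomeomorph_source
  have hqt : Ψ q ∈ H.target := H.map_source hqs
  obtain ⟨ε, hε, hball⟩ := Metric.isOpen_iff.1 H.open_target _ hqt
  refine ⟨H.source ∩ Ψ ⁻¹' Metric.ball (Ψ q) ε, H.open_source.inter (Metric.isOpen_ball.preimage hΨc),
    ⟨hqs, Metric.mem_ball_self hε⟩, ?_⟩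
  have key : ∀ x ∈ H.source ∩ Ψ ⁻¹' Metric.ball (Ψ q) ε, ∀ y ∈ H.source ∩ Ψ ⁻¹' Metric.ball (Ψ q) ε,
      φ x = φ y → ¬ (m x < m y) := by
    intro x hx y hy hxy hlt
    set s := (φ x).1 with hs
    have hmem : ∀ t ∈ Icc (m x) (m y), (s, t) ∈ H.target := by
      intro t ht
      apply hball
      have h1 := hx.2
      have h2 := hy.2
      simp only [mem_preimage, Metric.mem_ball, Prod.dist_eq, max_lt_iff, Ψ, Real.dist_eq, abs_lt] at h1 h2 ⊢
      refine ⟨h1.1, ?_, ?_⟩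
      · linarith [h1.2.1, ht.1]
      · linarith [h2.2.2, ht.2]
    let G : ℝ → ℝ × ℝ := fun t => H.symm (s, t)
    have hG : ∀ t ∈ Icc (m x) (m y), Ψ (G t) = (s, t) := fun t ht => H.right_inv (hmem t ht)
    have hGx : G (m x) = x := H.left_inv hx.1
    have hGy : G (m y) = y := by
      have : (s, m y) = Ψ y := by simp [Ψ, hs, hxy]
      simp only [G, this]; exact H.left_inv hy.1
    have hcont : ContinuousOn (fun t => (φ (G t)).2) (Icc (m x) (m y)) := by
      have h1 : ContinuousOn G (Icc (m x) (m y)) := by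
        refine H.continuousOn_symm.comp (by fun_prop) ?_
        intro t ht; exact hmem t ht
      exact (continuous_snd.comp hφ).comp_continuousOn h1
    obtain ⟨t, ht, hext⟩ := exists_isLocalExtr_Ioo hlt hcont (by simp only [hGx, hGy, hxy])
    have ht' : t ∈ Icc (m x) (m y) := Ioo_subset_Icc_self ht
    have hGs : G t ∈ H.source := H.map_target (hmem t ht')
    have hm : m (G t) = t := congrArg Prod.snd (hG t ht')
    have h1s : (φ (G t)).1 = s := (congrArg Prod.fst (hG t ht') :)
    have hback : ∀ w ∈ H.source, (φ w).1 = s → G (m w) = w := by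
      intro w hw hws
      have : (s, m w) = Ψ w := by simp [Ψ, hws]
      simp only [G, this]; exact H.left_inv hw
    have htend : Tendsto m (𝓝 (G t)) (𝓝 t) := by
      have := m.continuous.tendsto (G t); rwa [hm] at this
    rcases hext with hmin | hmax
    · have hev := (htend.eventually hmin).and (H.open_source.mem_nhds hGs)
      obtain ⟨δ, hδ, w, ⟨hw1, hw2⟩, hw⟩ := open_hits ho (G t) hev (-1)
      beta_reduce at hw1
      rw [hback w hw2 (by rw [hw]; exact h1s), hw] at hw1
      simp at hw1; linarith
    · have hev := (htend.eventually hmax).and (H.open_source.mem_nhds hGs)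
      obtain ⟨δ, hδ, w, ⟨hw1, hw2⟩, hw⟩ := open_hits ho (G t) hev 1
      beta_reduce at hw1
      rw [hback w hw2 (by rw [hw]; exact h1s), hw] at hw1
      simp at hw1; linarith
  intro x hx y hy hxy
  have h1 := key x hx y hy hxy
  have h2 := key y hy x hx hxy.symm
  apply H.injOn hx.1 hy.1
  have : m x = m y := le_antisymm (not_lt.1 h2) (not_lt.1 h1)
  simp [hHc, Ψ, hxy, this]
open Set Filter Topology

abbrev Lone := lp (fun _ : ℕ × ℕ => ℝ) 1

lemma Lone.summable (g : Lone) : Summable fun β => |g β| := by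
  have := (lp.memℓp g).summable (by simp)
  simpa using this

lemma Lone.norm_eq (g : Lone) : ‖g‖ = ∑' β, |g β| := by
  rw [lp.norm_eq_tsum_rpow (by simp)]; simp

lemma Lone.exists_of (h : ℕ × ℕ → ℝ) (hh : Summable fun β => |h β|) : ∃ g : Lone, ∀ β, g β = h β := by
  have : Memℓp h 1 := by
    rw [memℓp_gen_iff (by simp)]; simpa using hh
  exact ⟨⟨h, this⟩, fun β => rfl⟩

lemma Lone.lift {F : Type*} [NormedAddCommGroup F] [NormedSpace ℝ F] [CompleteSpace F]
    (v : ℕ × ℕ → F) (C : ℝ) (hC : 0 ≤ C) (hv : ∀ β, ‖v β‖ ≤ C) :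
    ∃ T : Lone →L[ℝ] F, ‖T‖ ≤ C ∧ ∀ g, HasSum (fun β => g β • v β) (T g) := by
  have hb : ∀ (g : Lone) β, ‖g β • v β‖ ≤ |g β| * C := by
    intro g β
    rw [norm_smul, Real.norm_eq_abs]
    exact mul_le_mul_of_nonneg_left (hv β) (abs_nonneg _)
  have hs : ∀ g : Lone, Summable fun β => g β • v β := fun g =>
    Summable.of_norm_bounded ((Lone.summable g).mul_right C) (hb g)
  let L : Lone →ₗ[ℝ] F :=
    { toFun := fun g => ∑' β, g β • v β
      map_add' := by
        intro g g'
        rw [← (hs g).tsum_add (hs g')]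
        congr 1; ext β; simp [add_smul]
      map_smul' := by
        intro c g
        simp only [RingHom.id_apply]
        rw [← (hs g).tsum_const_smul]
        congr 1; ext β; simp [mul_smul] }
  have hL : ∀ g, ‖L g‖ ≤ C * ‖g‖ := by
    intro g
    have := tsum_of_norm_bounded ((Lone.summable g).mul_right C).hasSum (hb g)
    rw [tsum_mul_right, ← Lone.norm_eq, mul_comm] at this
    exact this
  refine ⟨L.mkContinuous C hL, L.mkContinuous_norm_le hC hL, fun g => ?_⟩
  exact (hs g).hasSum

lemma hasSum_of_eq {ι : Type*} {f g : ι → ℝ} {a : ℝ} (h : HasSum f a) (hfg : ∀ i, g i = f i) :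
    HasSum g a := by
  rwa [show g = f from funext hfg]

lemma division_unit (e h : ℕ × ℕ → ℝ) (k : ℕ) (he : Summable fun α => |e α|)
    (he1 : ∑' α, |e α| < 1) (hh : Summable fun α => |h α|) :
    ∃ R : ℕ × ℕ → ℝ, (Summable fun α => |R α|) ∧ (∀ α, k ≤ α.2 → R α = 0) ∧
      ∀ x y : ℝ, |x| ≤ 1 → |y| ≤ 1 → ∃ Q : ℝ,
        ∑' α, h α * (x ^ α.1 * y ^ α.2) = ∑' α, R α * (x ^ α.1 * y ^ α.2)
          + Q * (y ^ k + ∑' α, e α * (x ^ α.1 * y ^ α.2)) := by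
  classical
  obtain ⟨e', he'⟩ := Lone.exists_of e he
  obtain ⟨h', hh'⟩ := Lone.exists_of h hh
  have hne : ‖e'‖ < 1 := by rw [Lone.norm_eq]; simpa [he'] using he1
  have hshift : ∀ β : ℕ × ℕ, ∃ S : Lone →L[ℝ] Lone, ‖S‖ ≤ 1 ∧
      ∀ g, HasSum (fun α => g α • (lp.single 1 (α.1 + β.1, α.2 + (β.2 - k)) (1:ℝ) : Lone)) (S g) := by
    intro β
    apply Lone.lift _ 1 zero_le_one
    intro α
    rw [lp.norm_single (by simp)]; simp
  choose S hS1 hS using hshift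
  let w : ℕ × ℕ → Lone := fun β => if β.2 < k then 0 else S β e'
  have hw : ∀ β, ‖w β‖ ≤ ‖e'‖ := by
    intro β
    simp only [w]
    split_ifs
    · simp
    · exact ((S β).le_opNorm e').trans (by
        have := mul_le_mul_of_nonneg_right (hS1 β) (norm_nonneg e'); simpa using this)
  obtain ⟨T, hT1, hT⟩ := Lone.lift w ‖e'‖ (norm_nonneg _) hw
  have hTl : ‖-T‖ < 1 := by rw [norm_neg]; exact hT1.trans_lt hne
  have hunit : IsUnit (1 - (-T)) := isUnit_one_sub_of_norm_lt_one hTl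
  obtain ⟨u, hu⟩ := hunit
  let g : Lone := (u⁻¹ : (Lone →L[ℝ] Lone)ˣ).val h'
  have hg : g + T g = h' := by
    have h1 : (u.val * (u⁻¹ : (Lone →L[ℝ] Lone)ˣ).val) h' = h' := by rw [Units.mul_inv]; rfl
    rw [hu] at h1
    simpa [g] using h1
  refine ⟨fun α => if α.2 < k then g α else 0, ?_, ?_, ?_⟩
  · refine Summable.of_nonneg_of_le (fun _ => abs_nonneg _) (fun α => ?_) (Lone.summable g)
    beta_reduce
    split_ifs <;> simp
  · intro α hα; simp [not_lt.2 hα]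
  intro x y hx hy
  have hmon : ∀ i j : ℕ, ‖x ^ i * y ^ j‖ ≤ 1 := by
    intro i j
    rw [norm_mul, norm_pow, norm_pow]
    exact mul_le_one₀ (pow_le_one₀ (norm_nonneg _) hx) (by positivity) (pow_le_one₀ (norm_nonneg _) hy)
  obtain ⟨V, -, hV⟩ := Lone.lift (fun β => x ^ β.1 * y ^ β.2) 1 zero_le_one (fun β => hmon _ _)
  have hVs : ∀ β : ℕ × ℕ, V (lp.single 1 β (1:ℝ)) = x ^ β.1 * y ^ β.2 := by
    intro β
    rw [← (hV _).tsum_eq, tsum_eq_single β]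
    · simp
    · intro b hb
      simp [hb]
  have hVS : ∀ β, V (S β e') = x ^ β.1 * y ^ (β.2 - k) * V e' := by
    intro β
    have h1 := V.hasSum (hS β e')
    have h2 := (hV e').mul_left (x ^ β.1 * y ^ (β.2 - k))
    refine h1.unique ?_
    refine hasSum_of_eq h2 (fun α => ?_)
    simp only [map_smul, hVs, smul_eq_mul, pow_add]
    ring
  have hVT : HasSum (fun β => g β * V (w β)) (V (T g)) := by
    have h1 := V.hasSum (hT g)
    refine hasSum_of_eq h1 (fun β => ?_)
    simp
  have sR : Summable fun α : ℕ × ℕ => (if α.2 < k then g α else 0) * (x ^ α.1 * y ^ α.2) := by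
    refine Summable.of_norm_bounded (Lone.summable g) (fun α => ?_)
    rw [norm_mul]
    refine (mul_le_of_le_one_right (norm_nonneg _) (hmon _ _)).trans ?_
    split_ifs <;> simp
  have sQ : Summable fun α : ℕ × ℕ => (if α.2 < k then 0 else g α) * (x ^ α.1 * y ^ (α.2 - k)) := by
    refine Summable.of_norm_bounded (Lone.summable g) (fun α => ?_)
    rw [norm_mul]
    refine (mul_le_of_le_one_right (norm_nonneg _) (hmon _ _)).trans ?_
    split_ifs <;> simp
  refine ⟨∑' α : ℕ × ℕ, (if α.2 < k then 0 else g α) * (x ^ α.1 * y ^ (α.2 - k)), ?_⟩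
  have hVe : ∑' α, e α * (x ^ α.1 * y ^ α.2) = V e' := by
    rw [← (hV e').tsum_eq]; simp [he']
  have hVh : ∑' α, h α * (x ^ α.1 * y ^ α.2) = V h' := by
    rw [← (hV h').tsum_eq]; simp [hh']
  rw [hVe, hVh]
  have h1 : HasSum (fun β => g β * (x ^ β.1 * y ^ β.2) + g β * V (w β)) (V h') := by
    rw [← hg, map_add]
    exact (hV g).add hVT
  refine h1.unique ?_
  have h2 := sR.hasSum.add (sQ.hasSum.mul_right (y ^ k + V e'))
  refine hasSum_of_eq h2 (fun β => ?_)
  by_cases hβ : β.2 < k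
  · simp [w, hβ]
  · simp only [w, hβ, if_false, hVS]
    have : y ^ β.2 = y ^ (β.2 - k) * y ^ k := by rw [← pow_add, Nat.sub_add_cancel (not_lt.1 hβ)]
    rw [this]; ring

/-- Sum of a double power series. -/
noncomputable def ev (c : ℕ × ℕ → ℝ) (z : ℝ × ℝ) : ℝ := ∑' α : ℕ × ℕ, c α * (z.1 ^ α.1 * z.2 ^ α.2)

/-- Convergence of a double power series. -/
def Cv (c : ℕ × ℕ → ℝ) : Prop := ∃ r : ℝ, 0 < r ∧ Summable fun α : ℕ × ℕ => |c α| * r ^ (α.1 + α.2)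

lemma summ_mono {c : ℕ × ℕ → ℝ} {r r' : ℝ} (h : Summable fun α : ℕ × ℕ => |c α| * r ^ (α.1 + α.2))
    (h0 : 0 ≤ r') (hr : r' ≤ r) : Summable fun α : ℕ × ℕ => |c α| * r' ^ (α.1 + α.2) := by
  refine Summable.of_nonneg_of_le (fun _ => by positivity) (fun α => ?_) h
  gcongr

lemma summ_ev {c : ℕ × ℕ → ℝ} {r : ℝ} (h : Summable fun α : ℕ × ℕ => |c α| * r ^ (α.1 + α.2))
    {x y : ℝ} (hx : |x| ≤ r) (hy : |y| ≤ r) : Summable fun α : ℕ × ℕ => c α * (x ^ α.1 * y ^ α.2) := by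
  refine Summable.of_norm_bounded h (fun α => ?_)
  rw [norm_mul, norm_mul, norm_pow, norm_pow, pow_add]
  simp only [Real.norm_eq_abs]
  have : 0 ≤ r := (abs_nonneg x).trans hx
  gcongr

lemma weier {f h : ℕ × ℕ → ℝ} (hf : Cv f) (hh : Cv h) (k : ℕ) (hk : f (0, k) ≠ 0)
    (hk' : ∀ j < k, f (0, j) = 0) :
    ∃ R : ℕ × ℕ → ℝ, Cv R ∧ (∀ α, k ≤ α.2 → R α = 0) ∧
      ∀ᶠ z in 𝓝 (0 : ℝ × ℝ), ∃ Q : ℝ, ev h z = ev R z + Q * ev f z := by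
  obtain ⟨ρ₁, hρ₁, hf⟩ := hf
  obtain ⟨ρ₂, hρ₂, hh⟩ := hh
  obtain ⟨ρ, hρ, hρ1, hρ2⟩ : ∃ ρ : ℝ, 0 < ρ ∧ ρ ≤ ρ₁ ∧ ρ ≤ ρ₂ :=
    ⟨min ρ₁ ρ₂, lt_min hρ₁ hρ₂, min_le_left _ _, min_le_right _ _⟩
  replace hf := summ_mono hf hρ.le hρ1
  replace hh := summ_mono hh hρ.le hρ2
  set M := ∑' α : ℕ × ℕ, |f α| * ρ ^ (α.1 + α.2) with hM
  have hM0 : 0 ≤ M := tsum_nonneg (fun _ => by positivity)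
  set f0 := f (0, k) with hf0
  have hf0' : 0 < |f0| := abs_pos.2 hk
  set K := M / (ρ ^ k * |f0|) with hK
  have hK0 : 0 ≤ K := by positivity
  obtain ⟨t, ht0, ht1, htK⟩ : ∃ t : ℝ, 0 < t ∧ t ≤ 1 ∧ t * K < 1 := by
    refine ⟨1 / (K + 1), by positivity, ?_, ?_⟩
    · rw [div_le_one (by positivity)]; linarith
    · rw [div_mul_eq_mul_div, div_lt_one (by positivity)]; linarith
  set s := ρ * t with hs
  set r := ρ * t ^ (k + 1) with hr
  have hs0 : 0 < s := by positivity
  have hr0 : 0 < r := by positivity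
  have hsρ : s ≤ ρ := mul_le_of_le_one_right hρ.le ht1
  have hrρ : r ≤ ρ := mul_le_of_le_one_right hρ.le (pow_le_one₀ ht0.le ht1)
  have hrs : r ≤ s := by
    rw [hr, hs]; gcongr; rw [pow_succ]
    exact mul_le_of_le_one_left ht0.le (pow_le_one₀ ht0.le ht1)
  let e : ℕ × ℕ → ℝ := fun α => f α / (f0 * s ^ k) * (r ^ α.1 * s ^ α.2) - if α = (0, k) then 1 else 0
  have hbig : ∀ α : ℕ × ℕ, k + 1 ≤ (k + 1) * α.1 + α.2 →
      |f α / (f0 * s ^ k) * (r ^ α.1 * s ^ α.2)| ≤ t / (ρ ^ k * |f0|) * (|f α| * ρ ^ (α.1 + α.2)) := by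
    intro α hα
    have h1 : r ^ α.1 * s ^ α.2 = ρ ^ (α.1 + α.2) * t ^ ((k + 1) * α.1 + α.2) := by
      rw [hr, hs, mul_pow, mul_pow, ← pow_mul, pow_add, pow_add t]; ring
    have h2 : t ^ ((k + 1) * α.1 + α.2) ≤ t ^ (k + 1) := pow_le_pow_of_le_one ht0.le ht1 hα
    rw [h1, abs_mul, abs_div, abs_mul, abs_of_pos (pow_pos hs0 k),
      abs_of_pos (by positivity : 0 < ρ ^ (α.1 + α.2) * t ^ ((k + 1) * α.1 + α.2))]
    calc |f α| / (|f0| * s ^ k) * (ρ ^ (α.1 + α.2) * t ^ ((k + 1) * α.1 + α.2))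
        ≤ |f α| / (|f0| * s ^ k) * (ρ ^ (α.1 + α.2) * t ^ (k + 1)) := by gcongr
      _ = _ := by
        rw [hs]; field_simp; rw [mul_pow, pow_succ]; ring
  have heb : ∀ α, |e α| ≤ t / (ρ ^ k * |f0|) * (|f α| * ρ ^ (α.1 + α.2)) := by
    rintro ⟨i, j⟩
    by_cases hα : k + 1 ≤ (k + 1) * i + j
    · have hne : ((i, j) : ℕ × ℕ) ≠ (0, k) := by
        rintro h; simp only [Prod.mk.injEq] at h; obtain ⟨rfl, rfl⟩ := h; omega
      simp only [e, hne, if_false, sub_zero]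
      exact hbig _ hα
    · have hi : i = 0 := by
        by_contra hi
        have : 1 ≤ i := Nat.one_le_iff_ne_zero.2 hi
        nlinarith
      subst hi
      have hj : j ≤ k := by omega
      have : e (0, j) = 0 := by
        rcases hj.lt_or_eq with h | h
        · simp [e, hk' j h, h.ne]
        · subst h
          simp only [e, ← hf0, if_true, pow_zero, one_mul]
          field_simp; simp
      rw [this, abs_zero]; positivity
  have hes : Summable fun α => |e α| :=
    Summable.of_nonneg_of_le (fun _ => abs_nonneg _) heb (hf.mul_left _)
  have he1 : ∑' α, |e α| < 1 := by
    have h1 := hes.tsum_le_tsum heb (hf.mul_left _)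
    rw [tsum_mul_left, ← hM] at h1
    refine h1.trans_lt ?_
    have h2 : t / (ρ ^ k * |f0|) * M = t * K := by rw [hK]; ring
    rw [h2]; exact htK
  have hh' : Summable fun α : ℕ × ℕ => |h α * (r ^ α.1 * s ^ α.2)| := by
    refine Summable.of_nonneg_of_le (fun _ => abs_nonneg _) (fun α => ?_) hh
    rw [abs_mul, abs_of_pos (by positivity : 0 < r ^ α.1 * s ^ α.2), pow_add]
    gcongr
  obtain ⟨R', hR's, hR'0, hR'⟩ := division_unit e (fun α => h α * (r ^ α.1 * s ^ α.2)) k hes he1 hh'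
  refine ⟨fun α => R' α / (r ^ α.1 * s ^ α.2), ⟨r, hr0, ?_⟩, ?_, ?_⟩
  · refine Summable.of_nonneg_of_le (fun _ => by positivity) (fun α => ?_) hR's
    rw [abs_div, abs_of_pos (by positivity : 0 < r ^ α.1 * s ^ α.2), div_mul_eq_mul_div, pow_add,
      div_le_iff₀ (by positivity)]
    gcongr
  · intro α hα; simp [hR'0 α hα]
  have hev : ∀ᶠ z in 𝓝 (0 : ℝ × ℝ), |z.1| < r ∧ |z.2| < s := by
    have h1 : ∀ᶠ z in 𝓝 (0 : ℝ × ℝ), |z.1| < r :=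
      (by fun_prop : Continuous fun z : ℝ × ℝ => |z.1|).continuousAt.eventually_lt
        continuousAt_const (by simpa using hr0)
    have h2 : ∀ᶠ z in 𝓝 (0 : ℝ × ℝ), |z.2| < s :=
      (by fun_prop : Continuous fun z : ℝ × ℝ => |z.2|).continuousAt.eventually_lt
        continuousAt_const (by simpa using hs0)
    exact h1.and h2
  filter_upwards [hev] with z hz
  have hx : |z.1 / r| ≤ 1 := by rw [abs_div, abs_of_pos hr0, div_le_one hr0]; exact hz.1.le
  have hy : |z.2 / s| ≤ 1 := by rw [abs_div, abs_of_pos hs0, div_le_one hs0]; exact hz.2.le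
  obtain ⟨Q, hQ⟩ := hR' (z.1 / r) (z.2 / s) hx hy
  refine ⟨Q / (f0 * s ^ k), ?_⟩
  have e1 : ev h z = ∑' α : ℕ × ℕ, h α * (r ^ α.1 * s ^ α.2) * ((z.1 / r) ^ α.1 * (z.2 / s) ^ α.2) := by
    unfold ev; congr 1; ext α; rw [div_pow, div_pow]; field_simp
  have e2 : ev (fun α => R' α / (r ^ α.1 * s ^ α.2)) z
      = ∑' α : ℕ × ℕ, R' α * ((z.1 / r) ^ α.1 * (z.2 / s) ^ α.2) := by
    unfold ev; congr 1; ext α; rw [div_pow, div_pow]; field_simp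
  have e3 : ∑' α : ℕ × ℕ, e α * ((z.1 / r) ^ α.1 * (z.2 / s) ^ α.2)
      = ev f z / (f0 * s ^ k) - (z.2 / s) ^ k := by
    have hs1 : HasSum (fun α : ℕ × ℕ => f α * (z.1 ^ α.1 * z.2 ^ α.2)) (ev f z) :=
      (summ_ev hf (hz.1.le.trans hrρ) (hz.2.le.trans hsρ)).hasSum
    have hs2 : HasSum (fun α : ℕ × ℕ => if α = (0, k) then (z.2 / s) ^ k else 0) ((z.2 / s) ^ k) :=
      hasSum_ite_eq _ _
    refine HasSum.tsum_eq (hasSum_of_eq ((hs1.div_const (f0 * s ^ k)).sub hs2) (fun α => ?_))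
    simp only [e, sub_mul, div_pow]
    congr 1
    · field_simp
    · split_ifs with h
      · subst h; simp
      · simp
  rw [e1, hQ, e2, e3]
  ring

/-- Coefficients of the first partial derivative. -/
def dX (c : ℕ × ℕ → ℝ) : ℕ × ℕ → ℝ := fun α => (α.1 + 1 : ℝ) * c (α.1 + 1, α.2)

/-- Coefficients of the second partial derivative. -/
def dY (c : ℕ × ℕ → ℝ) : ℕ × ℕ → ℝ := fun α => (α.2 + 1 : ℝ) * c (α.1, α.2 + 1)

lemma cast_succ_le_two_pow (n : ℕ) : (n : ℝ) ≤ 2 ^ n := by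
  exact_mod_cast (Nat.lt_two_pow_self (n := n)).le

lemma Cv.dY {c : ℕ × ℕ → ℝ} (h : Cv c) : Cv (dY c) := by
  obtain ⟨r, hr, h⟩ := h
  refine ⟨r / 2, by positivity, ?_⟩
  have hinj : Function.Injective (fun α : ℕ × ℕ => (α.1, α.2 + 1)) := by
    rintro ⟨a, b⟩ ⟨a', b'⟩ h; simpa using h
  have h1 := (h.comp_injective hinj).mul_left (2 / r)
  refine Summable.of_nonneg_of_le (fun _ => by positivity) (fun α => ?_) h1
  have h2 := cast_succ_le_two_pow (α.2 + 1)
  push_cast at h2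
  have h3 : (2 : ℝ) ^ (α.2 + 1) ≤ 2 ^ (α.1 + α.2 + 1) := pow_le_pow_right₀ (by norm_num) (by omega)
  simp only [_root_.dY, abs_mul, Function.comp, abs_of_pos (by positivity : (0:ℝ) < α.2 + 1)]
  calc ((α.2 : ℝ) + 1) * |c (α.1, α.2 + 1)| * (r / 2) ^ (α.1 + α.2)
      ≤ 2 ^ (α.1 + α.2 + 1) * |c (α.1, α.2 + 1)| * (r / 2) ^ (α.1 + α.2) := by gcongr; linarith
    _ = _ := by
      rw [div_pow, ← add_assoc, pow_succ, pow_succ r]; field_simp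

lemma Cv.dX {c : ℕ × ℕ → ℝ} (h : Cv c) : Cv (dX c) := by
  obtain ⟨r, hr, h⟩ := h
  refine ⟨r / 2, by positivity, ?_⟩
  have hinj : Function.Injective (fun α : ℕ × ℕ => (α.1 + 1, α.2)) := by
    rintro ⟨a, b⟩ ⟨a', b'⟩ h; simpa using h
  have h1 := (h.comp_injective hinj).mul_left (2 / r)
  refine Summable.of_nonneg_of_le (fun _ => by positivity) (fun α => ?_) h1
  have h2 := cast_succ_le_two_pow (α.1 + 1)
  push_cast at h2
  have h3 : (2 : ℝ) ^ (α.1 + 1) ≤ 2 ^ (α.1 + α.2 + 1) := pow_le_pow_right₀ (by norm_num) (by omega)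
  simp only [_root_.dX, abs_mul, Function.comp, abs_of_pos (by positivity : (0:ℝ) < α.1 + 1)]
  calc ((α.1 : ℝ) + 1) * |c (α.1 + 1, α.2)| * (r / 2) ^ (α.1 + α.2)
      ≤ 2 ^ (α.1 + α.2 + 1) * |c (α.1 + 1, α.2)| * (r / 2) ^ (α.1 + α.2) := by gcongr; linarith
    _ = _ := by
      rw [div_pow, add_right_comm α.1 1 α.2, pow_succ, pow_succ r]; field_simp

lemma ev_dY (c : ℕ × ℕ → ℝ) (z : ℝ × ℝ) :
    ∑' α : ℕ × ℕ, c α * (z.1 ^ α.1 * (α.2 * z.2 ^ (α.2 - 1))) = ev (dY c) z := by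
  have hinj : Function.Injective (fun α : ℕ × ℕ => (α.1, α.2 + 1)) := by
    rintro ⟨a, b⟩ ⟨a', b'⟩ h; simpa using h
  rw [← hinj.tsum_eq]
  · unfold ev dY; congr 1; ext α; simp; ring
  · rintro ⟨i, j⟩ h
    cases j with
    | zero => simp at h
    | succ j => exact ⟨(i, j), rfl⟩

lemma ev_dX (c : ℕ × ℕ → ℝ) (z : ℝ × ℝ) :
    ∑' α : ℕ × ℕ, c α * (α.1 * z.1 ^ (α.1 - 1) * z.2 ^ α.2) = ev (dX c) z := by
  have hinj : Function.Injective (fun α : ℕ × ℕ => (α.1 + 1, α.2)) := by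
    rintro ⟨a, b⟩ ⟨a', b'⟩ h; simpa using h
  rw [← hinj.tsum_eq]
  · unfold ev dX; congr 1; ext α; simp; ring
  · rintro ⟨i, j⟩ h
    cases i with
    | zero => simp at h
    | succ i => exact ⟨(i, j), rfl⟩

lemma mon_bound {x y r : ℝ} (hr : 0 < r) (hx : |x| ≤ r) (hy : |y| ≤ r) (i j : ℕ) :
    |i * x ^ (i - 1) * y ^ j| ≤ i * r ^ (i + j) / r := by
  cases i with
  | zero => simp
  | succ i =>
    rw [abs_mul, abs_mul, abs_pow, abs_pow, Nat.abs_cast, Nat.add_sub_cancel]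
    have : ((i + 1 : ℕ) : ℝ) * r ^ (i + 1 + j) / r = ((i + 1 : ℕ) : ℝ) * r ^ i * r ^ j := by
      rw [pow_add, pow_succ]; field_simp
    rw [this]; gcongr

lemma ev_hasFDerivAt {c : ℕ × ℕ → ℝ} (h : Cv c) : ∀ᶠ z in 𝓝 (0 : ℝ × ℝ),
    HasFDerivAt (ev c) (ev (dX c) z • ContinuousLinearMap.fst ℝ ℝ ℝ
      + ev (dY c) z • ContinuousLinearMap.snd ℝ ℝ ℝ) z := by
  obtain ⟨r, hr, h⟩ := h
  have hb : Metric.ball (0 : ℝ × ℝ) (r / 2) ∈ 𝓝 0 := Metric.ball_mem_nhds _ (by positivity)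
  let a : ℕ × ℕ → ℝ × ℝ → ℝ := fun α z => c α * (α.1 * z.1 ^ (α.1 - 1) * z.2 ^ α.2)
  let b : ℕ × ℕ → ℝ × ℝ → ℝ := fun α z => c α * (z.1 ^ α.1 * (α.2 * z.2 ^ (α.2 - 1)))
  have hball : ∀ z ∈ Metric.ball (0 : ℝ × ℝ) (r / 2), |z.1| ≤ r / 2 ∧ |z.2| ≤ r / 2 := by
    intro z hz
    rw [mem_ball_zero_iff, Prod.norm_def, max_lt_iff] at hz
    exact ⟨hz.1.le, hz.2.le⟩
  have hgen : ∀ n m : ℕ, n ≤ m → (n : ℝ) * (r / 2) ^ m / (r / 2) ≤ 2 / r * r ^ m := by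
    intro n m hnm
    have h1 : (n : ℝ) ≤ 2 ^ m := (Nat.cast_le.2 hnm).trans (cast_succ_le_two_pow m)
    calc (n : ℝ) * (r / 2) ^ m / (r / 2) ≤ 2 ^ m * (r / 2) ^ m / (r / 2) := by gcongr
      _ = _ := by rw [div_pow]; field_simp
  have hab : ∀ α, ∀ z ∈ Metric.ball (0 : ℝ × ℝ) (r / 2), |a α z| ≤ 2 / r * (|c α| * r ^ (α.1 + α.2)) := by
    intro α z hz
    obtain ⟨h1, h2⟩ := hball z hz
    have := (mon_bound (by positivity : 0 < r / 2) h1 h2 α.1 α.2).trans (hgen α.1 (α.1 + α.2) (by omega))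
    simp only [a]; rw [abs_mul]
    calc |c α| * |α.1 * z.1 ^ (α.1 - 1) * z.2 ^ α.2| ≤ |c α| * (2 / r * r ^ (α.1 + α.2)) := by gcongr
      _ = _ := by ring
  have hbb : ∀ α, ∀ z ∈ Metric.ball (0 : ℝ × ℝ) (r / 2), |b α z| ≤ 2 / r * (|c α| * r ^ (α.1 + α.2)) := by
    intro α z hz
    obtain ⟨h1, h2⟩ := hball z hz
    have := (mon_bound (by positivity : 0 < r / 2) h2 h1 α.2 α.1).trans (hgen α.2 (α.2 + α.1) (by omega))
    simp only [b]; rw [abs_mul, mul_comm (z.1 ^ α.1)]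
    calc |c α| * |α.2 * z.2 ^ (α.2 - 1) * z.1 ^ α.1| ≤ |c α| * (2 / r * r ^ (α.2 + α.1)) := by gcongr
      _ = _ := by rw [add_comm α.2]; ring
  filter_upwards [hb] with z hz
  have hsu := h.mul_left (2 / r)
  have key := hasFDerivAt_tsum_of_isPreconnected (𝕜 := ℝ) (f := fun α (z : ℝ × ℝ) => c α * (z.1 ^ α.1 * z.2 ^ α.2))
    (f' := fun α z => a α z • ContinuousLinearMap.fst ℝ ℝ ℝ + b α z • ContinuousLinearMap.snd ℝ ℝ ℝ)
    (x₀ := 0) (x := z)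
    (hsu.add hsu) Metric.isOpen_ball (convex_ball (0 : ℝ × ℝ) (r / 2)).isPreconnected
    (by
      intro α z _
      have h1 : HasFDerivAt (fun z : ℝ × ℝ => z.1) (ContinuousLinearMap.fst ℝ ℝ ℝ) z := hasFDerivAt_fst
      have h2 : HasFDerivAt (fun z : ℝ × ℝ => z.2) (ContinuousLinearMap.snd ℝ ℝ ℝ) z := hasFDerivAt_snd
      have h3 := (((hasDerivAt_pow α.1 z.1).comp_hasFDerivAt z h1).mul
        ((hasDerivAt_pow α.2 z.2).comp_hasFDerivAt z h2)).const_mul (c α)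
      refine h3.congr_fderiv ?_
      ext <;> simp [a, b]
      left; ring)
    (by
      intro α z hz
      refine (norm_add_le _ _).trans (add_le_add ?_ ?_)
      · rw [norm_smul]
        exact (mul_le_of_le_one_right (norm_nonneg _) (ContinuousLinearMap.norm_fst_le ..)).trans (hab α z hz)
      · rw [norm_smul]
        exact (mul_le_of_le_one_right (norm_nonneg _) (ContinuousLinearMap.norm_snd_le ..)).trans (hbb α z hz))
    (Metric.mem_ball_self (by positivity)) (summ_ev h (by simpa using hr.le) (by simpa using hr.le)) hz
  have hsa : Summable fun α => a α z := Summable.of_norm_bounded hsu (fun α => hab α z hz)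
  have hsb : Summable fun α => b α z := Summable.of_norm_bounded hsu (fun α => hbb α z hz)
  rw [(hsa.smul_const _).tsum_add (hsb.smul_const _), hsa.tsum_smul_const, hsb.tsum_smul_const] at key
  simp only [a, b, ev_dX, ev_dY] at key
  exact key

lemma ev_hasStrictFDerivAt {c : ℕ × ℕ → ℝ} (h : Cv c) : ∀ᶠ z in 𝓝 (0 : ℝ × ℝ),
    HasStrictFDerivAt (ev c) (ev (dX c) z • ContinuousLinearMap.fst ℝ ℝ ℝ
      + ev (dY c) z • ContinuousLinearMap.snd ℝ ℝ ℝ) z := by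
  filter_upwards [(ev_hasFDerivAt h).eventually_nhds, ev_hasFDerivAt h.dX, ev_hasFDerivAt h.dY] with z h1 h2 h3
  refine hasStrictFDerivAt_of_hasFDerivAt_of_continuousAt h1 ?_
  exact (h2.continuousAt.smul continuousAt_const).add (h3.continuousAt.smul continuousAt_const)

lemma ev_continuousAt_zero {c : ℕ × ℕ → ℝ} (h : Cv c) : ContinuousAt (ev c) 0 :=
  (ev_hasFDerivAt h).self_of_nhds.continuousAt

lemma ev_zero (c : ℕ × ℕ → ℝ) : ev c 0 = c (0, 0) := by
  unfold ev
  rw [tsum_eq_single (0, 0)]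
  · simp
  · rintro ⟨i, j⟩ h
    rcases Nat.eq_zero_or_pos i with rfl | hi
    · have : j ≠ 0 := by rintro rfl; exact h rfl
      simp [this]
    · simp [hi.ne']

lemma strip {c : ℕ × ℕ → ℝ} (h : Cv c) (hne : c ≠ 0) :
    ∃ (a : ℕ) (c' : ℕ × ℕ → ℝ), Cv c' ∧ (∀ z, ev c z = z.1 ^ a * ev c' z) ∧
      (∃ j, c' (0, j) ≠ 0 ∧ c (a, j) ≠ 0) := by
  classical
  have hex : ∃ a j, c (a, j) ≠ 0 := by
    by_contra! hcon
    exact hne (funext fun ⟨a, j⟩ => hcon a j)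
  let a := Nat.find hex
  obtain ⟨j, hj⟩ : ∃ j, c (a, j) ≠ 0 := Nat.find_spec hex
  have hlt : ∀ b < a, ∀ j, c (b, j) = 0 := by
    intro b hb j
    by_contra hcon
    exact Nat.find_min hex hb ⟨j, hcon⟩
  have hinj : Function.Injective (fun α : ℕ × ℕ => (α.1 + a, α.2)) := by
    rintro ⟨a, b⟩ ⟨a', b'⟩ h; simpa using h
  refine ⟨a, fun α => c (α.1 + a, α.2), ?_, ?_, j, ?_, hj⟩
  · obtain ⟨r, hr, h⟩ := h
    refine ⟨r, hr, ?_⟩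
    have h1 := (h.comp_injective hinj).mul_left ((r ^ a)⁻¹)
    refine h1.congr (fun α => ?_)
    simp only [Function.comp]
    rw [add_right_comm, pow_add r _ a]; field_simp
  · intro z
    unfold ev
    rw [← hinj.tsum_eq, ← tsum_mul_left]
    · congr 1; ext α; simp only [pow_add]; ring
    · rintro ⟨i, j⟩ hij
      rcases lt_or_ge i a with hi | hi
      · simp [hlt i hi j] at hij
      · exact ⟨(i - a, j), by simp [Nat.sub_add_cancel hi]⟩
  · simpa using hj

lemma exists_coeff {F : ℝ × ℝ → ℝ} (hF : AnalyticAt ℝ F 0) :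
    ∃ c : ℕ × ℕ → ℝ, Cv c ∧ ∀ᶠ z in 𝓝 (0 : ℝ × ℝ), F z = ev c z := by
  classical
  obtain ⟨p, R, hp⟩ := hF
  obtain ⟨r, hr0, hrR⟩ := ENNReal.lt_iff_exists_nnreal_btwn.1 hp.r_pos
  have hr : (0 : ℝ) < r := by exact_mod_cast hr0
  have hsum : Summable fun n => ‖p n‖ * (r : ℝ) ^ n := p.summable_norm_mul_pow (hrR.trans_le hp.r_le)
  let v : ∀ n : ℕ, Finset (Fin n) → Fin n → ℝ × ℝ := fun n s =>
    s.piecewise (fun _ => ((1 : ℝ), (0 : ℝ))) (fun _ => ((0 : ℝ), (1 : ℝ)))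
  let d : ℕ → ℕ → ℝ := fun n i => ∑ s : Finset (Fin n) with s.card = i, p n (v n s)
  let c : ℕ × ℕ → ℝ := fun α => d (α.1 + α.2) α.1
  have hmaps : ∀ n, ∀ s ∈ (Finset.univ : Finset (Finset (Fin n))), s.card ∈ Finset.range (n + 1) := by
    intro n s _
    have := Finset.card_le_univ s
    simp at this ⊢; omega
  have hpv : ∀ n s, |p n (v n s)| ≤ ‖p n‖ := by
    intro n s
    have h1 := (p n).le_opNorm (v n s)
    refine h1.trans (mul_le_of_le_one_right (norm_nonneg _) (Finset.prod_le_one (fun _ _ => norm_nonneg _) ?_))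
    intro i _
    simp only [v, Finset.piecewise]
    split_ifs <;> simp [Prod.norm_def]
  have hd : ∀ n, ∑ i ∈ Finset.range (n + 1), |d n i| ≤ 2 ^ n * ‖p n‖ := by
    intro n
    calc ∑ i ∈ Finset.range (n + 1), |d n i|
        ≤ ∑ i ∈ Finset.range (n + 1), ∑ s : Finset (Fin n) with s.card = i, |p n (v n s)| :=
          Finset.sum_le_sum fun i _ => Finset.abs_sum_le_sum_abs _ _
      _ = ∑ s : Finset (Fin n), |p n (v n s)| := Finset.sum_fiberwise_of_maps_to (hmaps n) _
      _ ≤ ∑ s : Finset (Fin n), ‖p n‖ := Finset.sum_le_sum fun s _ => hpv n s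
      _ = _ := by simp
  have hpz : ∀ n (z : ℝ × ℝ), p n (fun _ => z) = ∑ i ∈ Finset.range (n + 1), d n i * (z.1 ^ i * z.2 ^ (n - i)) := by
    intro n z
    have hz : (fun _ : Fin n => z) = (fun _ => z.1 • ((1 : ℝ), (0 : ℝ))) + (fun _ => z.2 • ((0 : ℝ), (1 : ℝ))) := by
      ext <;> simp
    have hs : ∀ s : Finset (Fin n), p n (s.piecewise (fun _ => z.1 • ((1 : ℝ), (0 : ℝ))) (fun _ => z.2 • ((0 : ℝ), (1 : ℝ))))
        = p n (v n s) * (z.1 ^ s.card * z.2 ^ (n - s.card)) := by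
      intro s
      have h1 : s.piecewise (fun _ => z.1 • ((1 : ℝ), (0 : ℝ))) (fun _ => z.2 • ((0 : ℝ), (1 : ℝ)))
          = fun i => (s.piecewise (fun _ => z.1) (fun _ => z.2) i) • v n s i := by
        ext i <;> by_cases hi : i ∈ s <;> simp [v, hi]
      rw [h1, (p n).map_smul_univ, Finset.prod_piecewise]
      simp [Finset.card_sdiff, mul_comm]
    rw [hz, ContinuousMultilinearMap.map_add_univ, ← Finset.sum_fiberwise_of_maps_to (hmaps n)]
    refine Finset.sum_congr rfl fun i _ => ?_
    simp only [d]
    rw [Finset.sum_mul]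
    refine Finset.sum_congr rfl fun s hs' => ?_
    rw [hs s, (Finset.mem_filter.1 hs').2]
  have hanti : ∀ n (G : ℝ → ℕ → ℕ → ℝ), ∑ α ∈ Finset.HasAntidiagonal.antidiagonal n, G (c α) α.1 α.2
      = ∑ i ∈ Finset.range (n + 1), G (d n i) i (n - i) := by
    intro n G
    rw [← Finset.Nat.sum_antidiagonal_eq_sum_range_succ_mk (fun α : ℕ × ℕ => G (d n α.1) α.1 α.2)]
    refine Finset.sum_congr rfl fun α hα => ?_
    rw [Finset.HasAntidiagonal.mem_antidiagonal] at hα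
    simp only [c, hα]
  have hcs : Summable fun α : ℕ × ℕ => |c α| * ((r : ℝ) / 2) ^ (α.1 + α.2) := by
    rw [← Finset.HasAntidiagonal.sigmaAntidiagonalEquivProd.summable_iff]
    rw [summable_sigma_of_nonneg (fun _ => by simp only [Function.comp]; positivity)]
    refine ⟨fun n => (hasSum_fintype _).summable, ?_⟩
    refine Summable.of_nonneg_of_le (fun n => tsum_nonneg fun _ => by simp only [Function.comp]; positivity) (fun n => ?_) hsum
    rw [tsum_fintype]
    have h1 : ∑ b : Finset.HasAntidiagonal.antidiagonal n, |c b.1| * ((r : ℝ) / 2) ^ (b.1.1 + b.1.2)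
        = ∑ α ∈ Finset.HasAntidiagonal.antidiagonal n, |c α| * ((r : ℝ) / 2) ^ (α.1 + α.2) :=
      Finset.sum_coe_sort (Finset.HasAntidiagonal.antidiagonal n) (fun α : ℕ × ℕ => |c α| * ((r : ℝ) / 2) ^ (α.1 + α.2))
    refine le_trans (le_of_eq h1) ?_
    have h2 : ∑ α ∈ Finset.HasAntidiagonal.antidiagonal n, |c α| * ((r : ℝ) / 2) ^ (α.1 + α.2)
        = (∑ i ∈ Finset.range (n + 1), |d n i|) * ((r : ℝ) / 2) ^ n := by
      rw [← hanti n (fun a _ _ => |a|), Finset.sum_mul]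
      refine Finset.sum_congr rfl fun α hα => ?_
      rw [Finset.HasAntidiagonal.mem_antidiagonal.1 hα]
    rw [h2]
    calc _ ≤ (2 ^ n * ‖p n‖) * ((r : ℝ) / 2) ^ n := by gcongr; exact hd n
      _ = _ := by rw [div_pow]; field_simp
  refine ⟨c, ⟨r / 2, by positivity, hcs⟩, ?_⟩
  have hb : Metric.ball (0 : ℝ × ℝ) (r / 2) ∈ 𝓝 0 := Metric.ball_mem_nhds _ (by positivity)
  filter_upwards [hb] with z hz
  have hz' := hz
  rw [mem_ball_zero_iff, Prod.norm_def, max_lt_iff] at hz'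
  have hzR : z ∈ Metric.eball (0 : ℝ × ℝ) R := by
    refine Metric.eball_subset_eball hrR.le ?_
    rw [Metric.eball_coe]
    exact Metric.ball_subset_ball (by linarith) hz
  have h1 := hp.hasSum hzR
  rw [zero_add] at h1
  have h2 := (summ_ev hcs hz'.1.le hz'.2.le).hasSum
  rw [← Finset.HasAntidiagonal.sigmaAntidiagonalEquivProd.hasSum_iff] at h2
  have h3 := h2.sigma (fun n => hasSum_fintype _)
  refine h1.unique (hasSum_of_eq h3 (fun n => ?_))
  rw [hpz, ← hanti n (fun a i j => a * (z.1 ^ i * z.2 ^ j))]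
  exact (Finset.sum_coe_sort (Finset.HasAntidiagonal.antidiagonal n) (fun α : ℕ × ℕ => c α * (z.1 ^ α.1 * z.2 ^ α.2))).symm

lemma rolle_chain (g : ℕ → ℝ → ℝ) (hg : ∀ j y, HasDerivAt (g j) (g (j + 1) y) y) (a b : ℝ) (m : ℕ)
    (hv : ∀ j < m, g j a = 0) (hab : b ≠ a) (hb : g 0 b = 0) :
    ∀ j ≤ m, ∃ ξ ∈ uIcc a b, ξ ≠ a ∧ g j ξ = 0 := by
  intro j
  induction j with
  | zero => intro _; exact ⟨b, right_mem_uIcc, hab, hb⟩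
  | succ j ih =>
    intro hj
    obtain ⟨ξ, hξ, hne, h0⟩ := ih (by omega)
    have hja := hv j (by omega)
    have hc : Continuous (g j) := continuous_iff_continuousAt.2 fun y => (hg j y).continuousAt
    rcases lt_or_gt_of_ne hne with h | h
    · obtain ⟨η, hη, hη0⟩ := exists_hasDerivAt_eq_zero h hc.continuousOn (by rw [h0, hja])
        (fun x _ => hg j x)
      refine ⟨η, ?_, hη.2.ne, hη0⟩
      exact uIcc_subset_uIcc hξ left_mem_uIcc (Icc_subset_uIcc ⟨hη.1.le, hη.2.le⟩)
    · obtain ⟨η, hη, hη0⟩ := exists_hasDerivAt_eq_zero h hc.continuousOn (by rw [h0, hja])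
        (fun x _ => hg j x)
      refine ⟨η, ?_, hη.1.ne', hη0⟩
      exact uIcc_subset_uIcc hξ left_mem_uIcc (Icc_subset_uIcc' ⟨hη.1.le, hη.2.le⟩)

lemma fold {φ : ℝ × ℝ → ℝ × ℝ} (ho : IsOpenMap φ) (d : ℕ → ℝ × ℝ → ℝ) (h0 : ∀ z, d 0 z = (φ z).1)
    (hd : ∀ j x y, HasDerivAt (fun y => d j (x, y)) (d (j + 1) (x, y)) y) (m : ℕ) (hm : 1 ≤ m)
    (g : ℝ → ℝ) (t : ℝ) (hg : ContinuousAt g t) (hdm : ContinuousAt (d m) (t, g t))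
    (hne : d m (t, g t) ≠ 0) (hconst : ∀ᶠ x in 𝓝 t, φ (x, g x) = φ (t, g t))
    (hvan : ∀ᶠ x in 𝓝 t, ∀ j, 1 ≤ j → j < m → d j (x, g x) = 0) : False := by
  obtain ⟨ε, hε, hball⟩ := Metric.eventually_nhds_iff_ball.1 (hdm.eventually_ne hne)
  have htend : Tendsto (fun z : ℝ × ℝ => z.1) (𝓝 (t, g t)) (𝓝 t) := continuous_fst.continuousAt
  have h1 : ∀ᶠ z : ℝ × ℝ in 𝓝 (t, g t), z ∈ Metric.ball (t, g t) ε := Metric.ball_mem_nhds _ hε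
  have h2 : ∀ᶠ x in 𝓝 t, (x, g x) ∈ Metric.ball (t, g t) ε :=
    (continuousAt_id.prodMk hg).eventually (Metric.ball_mem_nhds _ hε)
  obtain ⟨δ, hδ, ⟨x, y⟩, ⟨hw1, hw2, hw3, hw4⟩, hw⟩ := open_hits ho (t, g t)
    (h1.and ((htend.eventually h2).and ((htend.eventually hconst).and (htend.eventually hvan)))) 1
  dsimp only at hw1 hw2 hw3 hw4
  have hyg : y ≠ g x := by
    rintro rfl
    rw [hw3] at hw
    have := congrArg Prod.snd hw
    dsimp at this; linarith
  obtain ⟨ξ, hξ, -, hξ0⟩ := rolle_chain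
    (fun j y => d j (x, y) - if j = 0 then (φ (t, g t)).1 else 0)
    (fun j y => by simpa using hd j x y) (g x) y m
    (by
      intro j hj
      rcases Nat.eq_zero_or_pos j with rfl | hj0
      · simp [h0, hw3]
      · simp [hj0.ne', hw4 j hj0 hj])
    hyg (by simp [h0, hw]) m le_rfl
  have hm0 : m ≠ 0 := by omega
  simp only [hm0, if_false, sub_zero] at hξ0
  refine hball (x, ξ) ?_ hξ0
  simp only [Metric.mem_ball, Prod.dist_eq, max_lt_iff, Real.dist_eq, abs_lt] at hw1 hw2 ⊢
  refine ⟨hw1.1, ?_⟩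
  rcases mem_uIcc.1 hξ with h | h
  · constructor <;> linarith [h.1, h.2, hw1.2.1, hw1.2.2, hw2.2.1, hw2.2.2]
  · constructor <;> linarith [h.1, h.2, hw1.2.1, hw1.2.2, hw2.2.1, hw2.2.2]

/-- Iterated derivatives in the second variable. -/
noncomputable def Dy (φ : ℝ × ℝ → ℝ × ℝ) : ℕ → ℝ × ℝ → ℝ × ℝ
  | 0 => φ
  | j + 1 => fun z => fderiv ℝ (Dy φ j) z (0, 1)

lemma Dy_analytic {φ : ℝ × ℝ → ℝ × ℝ} (hφ : ∀ z, AnalyticAt ℝ φ z) (j : ℕ) :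
    ∀ z, AnalyticAt ℝ (Dy φ j) z := by
  induction j with
  | zero => exact hφ
  | succ j ih => intro z; exact ((ContinuousLinearMap.apply ℝ (ℝ × ℝ) ((0 : ℝ), (1 : ℝ))).analyticAt _).comp (ih z).fderiv

lemma Dy_hasDerivAt {φ : ℝ × ℝ → ℝ × ℝ} (hφ : ∀ z, AnalyticAt ℝ φ z) (j : ℕ) (x y : ℝ) :
    HasDerivAt (fun y => Dy φ j (x, y)) (Dy φ (j + 1) (x, y)) y := by
  have h1 : HasFDerivAt (Dy φ j) (fderiv ℝ (Dy φ j) (x, y)) (x, y) :=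
    (Dy_analytic hφ j (x, y)).differentiableAt.hasFDerivAt
  have h2 : HasDerivAt (fun y : ℝ => (x, y)) ((0 : ℝ), (1 : ℝ)) y :=
    (hasDerivAt_const y x).prodMk (hasDerivAt_id y)
  exact h1.comp_hasDerivAt y h2

lemma Dy_iteratedDeriv {φ : ℝ × ℝ → ℝ × ℝ} (hφ : ∀ z, AnalyticAt ℝ φ z) (x : ℝ) (j : ℕ) :
    iteratedDeriv j (fun y => φ (x, y)) = fun y => Dy φ j (x, y) := by
  induction j with
  | zero => simp [Dy]
  | succ j ih =>
    rw [iteratedDeriv_succ, ih]; ext1 y; exact (Dy_hasDerivAt hφ j x y).deriv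

lemma arc_contra {φ : ℝ × ℝ → ℝ × ℝ} (hφ : ∀ z, AnalyticAt ℝ φ z) (ho : IsOpenMap φ)
    {F a b : ℝ × ℝ → ℝ} (q : ℝ × ℝ)
    (hF : ∀ᶠ z in 𝓝 q, HasStrictFDerivAt F (a z • ContinuousLinearMap.fst ℝ ℝ ℝ
      + b z • ContinuousLinearMap.snd ℝ ℝ ℝ) z)
    (hb : ∀ᶠ z in 𝓝 q, b z ≠ 0) (hFq : F q = 0)
    (hD : ∀ᶠ z in 𝓝 q, F z = 0 → fderiv ℝ φ z = 0) : False := by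
  let Ψ : ℝ × ℝ → ℝ × ℝ := fun z => (z.1, F z)
  have hΨ : ∀ z, HasStrictFDerivAt F (a z • ContinuousLinearMap.fst ℝ ℝ ℝ
      + b z • ContinuousLinearMap.snd ℝ ℝ ℝ) z → b z ≠ 0 →
      ∃ e : (ℝ × ℝ) ≃L[ℝ] (ℝ × ℝ), HasStrictFDerivAt Ψ (e : (ℝ × ℝ) →L[ℝ] (ℝ × ℝ)) z := by
    intro z h1 h2
    obtain ⟨e, he⟩ := exists_clequiv ((ContinuousLinearMap.fst ℝ ℝ ℝ).prod
      (a z • ContinuousLinearMap.fst ℝ ℝ ℝ + b z • ContinuousLinearMap.snd ℝ ℝ ℝ)) (by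
        rintro ⟨x, y⟩ h
        simp at h
        obtain ⟨rfl, h⟩ := h
        simp [h2] at h
        simp [h])
    refine ⟨e, ?_⟩
    rw [he]
    exact hasStrictFDerivAt_fst.prodMk h1
  obtain ⟨e, he⟩ := hΨ q hF.self_of_nhds hb.self_of_nhds
  let H := he.toOpenPartialHomeomorph Ψ
  have hqs : q ∈ H.source := he.mem_toOpenPartialHomeomorph_source
  have hΨq : Ψ q = (q.1, 0) := by simp [Ψ, hFq]
  have hqt : (q.1, (0 : ℝ)) ∈ H.target := by rw [← hΨq]; exact H.map_source hqs
  let γ : ℝ → ℝ × ℝ := fun t => H.symm (t, 0)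
  have hγq : γ q.1 = q := by
    simp only [γ, ← hΨq]; exact H.left_inv hqs
  have hpair : ContinuousAt (fun t : ℝ => (t, (0 : ℝ))) q.1 := by fun_prop
  have hγc : ContinuousAt γ q.1 := by
    have h1 : ContinuousAt H.symm (q.1, (0 : ℝ)) := H.continuousAt_symm hqt
    exact ContinuousAt.comp (f := fun t : ℝ => (t, (0 : ℝ))) h1 hpair
  have hev : ∀ᶠ t in 𝓝 q.1, (t, (0 : ℝ)) ∈ H.target ∧ (HasStrictFDerivAt F (a (γ t) • ContinuousLinearMap.fst ℝ ℝ ℝ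
      + b (γ t) • ContinuousLinearMap.snd ℝ ℝ ℝ) (γ t)) ∧ b (γ t) ≠ 0 ∧ (F (γ t) = 0 → fderiv ℝ φ (γ t) = 0) := by
    have h1 : ∀ᶠ t in 𝓝 q.1, (t, (0 : ℝ)) ∈ H.target := hpair.eventually (H.open_target.mem_nhds hqt)
    have ht : Tendsto γ (𝓝 q.1) (𝓝 q) := by have := hγc.tendsto; rwa [hγq] at this
    exact h1.and (ht.eventually (hF.and (hb.and hD)))
  obtain ⟨ε, hε, hI⟩ := Metric.eventually_nhds_iff_ball.1 hev
  set I := Metric.ball q.1 ε with hIdef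
  have hqI : q.1 ∈ I := Metric.mem_ball_self hε
  have hΨγ : ∀ t ∈ I, Ψ (γ t) = (t, 0) := fun t ht => H.right_inv (hI t ht).1
  have hγ1 : ∀ t ∈ I, (γ t).1 = t := fun t ht => congrArg Prod.fst (hΨγ t ht)
  have hγF : ∀ t ∈ I, F (γ t) = 0 := fun t ht => congrArg Prod.snd (hΨγ t ht)
  have hγd : ∀ t ∈ I, ∃ v, HasDerivAt γ v t := by
    intro t ht
    obtain ⟨h1, h2, h3, h4⟩ := hI t ht
    obtain ⟨e', he'⟩ := hΨ (γ t) h2 h3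
    have h5 : HasFDerivAt H.symm (e'.symm : (ℝ × ℝ) →L[ℝ] (ℝ × ℝ)) (t, 0) :=
      H.hasFDerivAt_symm h1 he'.hasFDerivAt
    have h6 : HasDerivAt (fun t : ℝ => (t, (0 : ℝ))) ((1 : ℝ), (0 : ℝ)) t :=
      (hasDerivAt_id t).prodMk (hasDerivAt_const t 0)
    exact ⟨_, h5.comp_hasDerivAt t h6⟩
  have hφγ : ∀ t ∈ I, HasDerivAt (fun t => φ (γ t)) 0 t := by
    intro t ht
    obtain ⟨v, hv⟩ := hγd t ht
    have h1 := (hφ (γ t)).differentiableAt.hasFDerivAt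
    rw [(hI t ht).2.2.2 (hγF t ht)] at h1
    simpa using! h1.comp_hasDerivAt t hv
  have hconst : ∀ t ∈ I, φ (γ t) = φ q := by
    intro t ht
    have := Metric.isOpen_ball.is_const_of_deriv_eq_zero (convex_ball q.1 ε).isPreconnected
      (f := fun t => φ (γ t)) (fun t ht => (hφγ t ht).differentiableAt.differentiableWithinAt)
      (fun t ht => (hφγ t ht).deriv) ht hqI
    simpa [hγq] using this
  have hγeq : ∀ t ∈ I, γ t = (t, (γ t).2) := fun t ht => Prod.ext (hγ1 t ht) rfl
  have hIn : ∀ t ∈ I, ∀ᶠ x in 𝓝 t, x ∈ I := fun t ht => Metric.isOpen_ball.mem_nhds ht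
  by_cases hex : ∃ m, 1 ≤ m ∧ ∃ t ∈ I, Dy φ m (γ t) ≠ 0
  · classical
    obtain ⟨hm1, t, ht, hne⟩ := Nat.find_spec hex
    set m := Nat.find hex with hm
    have hmin : ∀ j, 1 ≤ j → j < m → ∀ x ∈ I, Dy φ j (γ x) = 0 := by
      intro j hj1 hj x hx
      by_contra hcon
      exact Nat.find_min hex hj ⟨hj1, x, hx, hcon⟩
    obtain ⟨v, hv⟩ := hγd t ht
    have hg : ContinuousAt (fun t => (γ t).2) t := hv.continuousAt.snd
    have hcst : ∀ᶠ x in 𝓝 t, φ (x, (γ x).2) = φ (t, (γ t).2) := by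
      filter_upwards [hIn t ht] with x hx
      rw [← hγeq x hx, ← hγeq t ht, hconst x hx, hconst t ht]
    have hvan : ∀ᶠ x in 𝓝 t, ∀ j, 1 ≤ j → j < m → Dy φ j (x, (γ x).2) = 0 := by
      filter_upwards [hIn t ht] with x hx j hj1 hj
      rw [← hγeq x hx]; exact hmin j hj1 hj x hx
    rw [hγeq t ht] at hne
    have hc := (Dy_analytic hφ m (t, (γ t).2)).continuousAt
    by_cases h1 : (Dy φ m (t, (γ t).2)).1 = 0
    · have h2 : (Dy φ m (t, (γ t).2)).2 ≠ 0 := fun h2 => hne (Prod.ext h1 h2)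
      refine fold (φ := fun z => (φ z).swap) ((Homeomorph.prodComm ℝ ℝ).isOpenMap.comp ho)
        (fun j z => (Dy φ j z).2) (fun z => rfl) (fun j x y => (Dy_hasDerivAt hφ j x y).snd) m hm1
        (fun t => (γ t).2) t hg hc.snd h2 ?_ ?_
      · filter_upwards [hcst] with x hx; rw [hx]
      · filter_upwards [hvan] with x hx j hj1 hj; rw [hx j hj1 hj]; rfl
    · refine fold ho
        (fun j z => (Dy φ j z).1) (fun z => rfl) (fun j x y => (Dy_hasDerivAt hφ j x y).fst) m hm1
        (fun t => (γ t).2) t hg hc.fst h1 hcst ?_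
      filter_upwards [hvan] with x hx j hj1 hj; rw [hx j hj1 hj]; rfl
  · push Not at hex
    have hall : ∀ t ∈ I, ∀ y, φ (t, y) = φ q := by
      intro t ht
      have han : AnalyticOnNhd ℝ (fun y => φ (t, y)) univ := by
        intro y _
        exact (hφ (t, y)).comp₂ analyticAt_const analyticAt_id
      have hord : analyticOrderAt (fun y => φ (t, y) - φ q) (γ t).2 = ⊤ := by
        rw [ENat.eq_top_iff_forall_ge]
        intro n
        rw [natCast_le_analyticOrderAt_iff_iteratedDeriv_eq_zero ((han _ trivial).fun_sub analyticAt_const)]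
        intro i _
        rcases Nat.eq_zero_or_pos i with rfl | hi
        · simp only [iteratedDeriv_zero]
          rw [← hγeq t ht, hconst t ht, sub_self]
        · obtain ⟨k, rfl⟩ : ∃ k, i = k + 1 := ⟨i - 1, by omega⟩
          rw [iteratedDeriv_succ', show deriv (fun y => φ (t, y) - φ q) = deriv (fun y => φ (t, y)) from
            funext fun y => deriv_sub_const _, ← iteratedDeriv_succ', Dy_iteratedDeriv hφ]
          dsimp only
          rw [← hγeq t ht]
          exact hex _ (by omega) t ht
      rw [analyticOrderAt_eq_top] at hord
      have h1 : (fun y => φ (t, y)) =ᶠ[𝓝 (γ t).2] fun _ => φ q := by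
        filter_upwards [hord] with y hy using sub_eq_zero.1 hy
      have := han.eq_of_eventuallyEq (analyticOnNhd_const) h1
      exact fun y => congrFun this y
    have hP : ∀ᶠ z in 𝓝 q, z.1 ∈ I :=
      (continuous_fst.continuousAt : ContinuousAt (fun z : ℝ × ℝ => z.1) q).eventually (hIn _ hqI)
    obtain ⟨δ, hδ, w, hw1, hw⟩ := open_hits ho q hP 1
    rw [hall w.1 hw1 w.2] at hw
    have := congrArg Prod.snd hw
    dsimp at this; linarith

/-- The four entries of a linear map of the plane. -/
noncomputable def Ent (i : Bool × Bool) : ((ℝ × ℝ) →L[ℝ] (ℝ × ℝ)) →L[ℝ] ℝ :=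
  (if i.1 then ContinuousLinearMap.fst ℝ ℝ ℝ else ContinuousLinearMap.snd ℝ ℝ ℝ).comp
    (ContinuousLinearMap.apply ℝ (ℝ × ℝ) (if i.2 then ((1 : ℝ), (0 : ℝ)) else ((0 : ℝ), (1 : ℝ))))

lemma Ent_zero {L : (ℝ × ℝ) →L[ℝ] (ℝ × ℝ)} (h : ∀ i, Ent i L = 0) : L = 0 := by
  have h1 := h (true, true)
  have h2 := h (true, false)
  have h3 := h (false, true)
  have h4 := h (false, false)
  simp [Ent] at h1 h2 h3 h4
  ext <;> simp [*]

lemma main_crit {φ : ℝ × ℝ → ℝ × ℝ} (hφ : ∀ z, AnalyticAt ℝ φ z) (ho : IsOpenMap φ) :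
    ¬ ∃ᶠ z in 𝓝 (0 : ℝ × ℝ), z.1 ≠ 0 ∧ fderiv ℝ φ z = 0 := by
  classical
  intro hfr
  have hc : ∀ i, ∃ c, Cv c ∧ ∀ᶠ z in 𝓝 (0 : ℝ × ℝ), Ent i (fderiv ℝ φ z) = ev c z := fun i =>
    exists_coeff (F := fun z => Ent i (fderiv ℝ φ z))
      (((Ent i).analyticAt _).comp (hφ 0).fderiv)
  choose c hcv hce using hc
  have hce' := eventually_all.2 hce
  have hstep : ∀ d : ℕ × ℕ → ℝ, Cv d → d ≠ 0 →
      (∃ᶠ z in 𝓝 (0 : ℝ × ℝ), z.1 ≠ 0 ∧ fderiv ℝ φ z = 0 ∧ ev d z = 0) →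
      ∃ a d' j, Cv d' ∧ (∃ᶠ z in 𝓝 (0 : ℝ × ℝ), z.1 ≠ 0 ∧ fderiv ℝ φ z = 0 ∧ ev d' z = 0) ∧
        d' (0, j) ≠ 0 ∧ d (a, j) ≠ 0 := by
    intro d hd hne hfq
    obtain ⟨a, d', hd', he, j, hj1, hj2⟩ := strip hd hne
    refine ⟨a, d', j, hd', hfq.mono ?_, hj1, hj2⟩
    rintro z ⟨h1, h2, h3⟩
    refine ⟨h1, h2, ?_⟩
    rw [he] at h3
    exact (mul_eq_zero.1 h3).resolve_left (pow_ne_zero _ h1)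
  have hex : ∃ k, ∃ d : ℕ × ℕ → ℝ, Cv d ∧
      (∃ᶠ z in 𝓝 (0 : ℝ × ℝ), z.1 ≠ 0 ∧ fderiv ℝ φ z = 0 ∧ ev d z = 0) ∧ d (0, k) ≠ 0 := by
    by_cases hall : ∀ i, c i = 0
    · exfalso
      have h0 : ∀ᶠ z in 𝓝 (0 : ℝ × ℝ), fderiv ℝ φ z = 0 := by
        filter_upwards [hce'] with z hz
        refine Ent_zero fun i => ?_
        rw [hz i, hall i]; simp [ev]
      obtain ⟨ε, hε, hball⟩ := Metric.eventually_nhds_iff_ball.1 h0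
      obtain ⟨δ, hδ, w, hw1, hw⟩ := open_hits ho 0 (Metric.ball_mem_nhds (0 : ℝ × ℝ) hε) 1
      have := Metric.isOpen_ball.is_const_of_fderiv_eq_zero (𝕜 := ℝ)
        (convex_ball (0 : ℝ × ℝ) ε).isPreconnected
        (f := φ) (fun t ht => (hφ t).differentiableAt.differentiableWithinAt)
        hball hw1 (Metric.mem_ball_self hε)
      rw [this] at hw
      have := congrArg Prod.snd hw
      dsimp at this; linarith
    · push Not at hall
      obtain ⟨i, hi⟩ := hall
      obtain ⟨a, d', j, h1, h2, h3, -⟩ := hstep (c i) (hcv i) hi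
        ((hfr.and_eventually (hce i)).mono (by
          rintro z ⟨⟨h1, h2⟩, h3⟩
          refine ⟨h1, h2, ?_⟩
          rw [← h3, h2, map_zero]))
      exact ⟨j, d', h1, h2, h3⟩
  obtain ⟨d, hd, hfd, hk⟩ := Nat.find_spec hex
  have hmin : ∀ j < Nat.find hex, ∀ d : ℕ × ℕ → ℝ, Cv d →
      (∃ᶠ z in 𝓝 (0 : ℝ × ℝ), z.1 ≠ 0 ∧ fderiv ℝ φ z = 0 ∧ ev d z = 0) → d (0, j) = 0 := by
    intro j hj d h1 h2
    by_contra h3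
    exact Nat.find_min hex hj ⟨d, h1, h2, h3⟩
  generalize Nat.find hex = k at hk hmin
  have hk' : ∀ j < k, d (0, j) = 0 := fun j hj => hmin j hj d hd hfd
  have hk0 : k ≠ 0 := by
    rintro rfl
    have h1 : ∀ᶠ z in 𝓝 (0 : ℝ × ℝ), ev d z ≠ 0 :=
      (ev_continuousAt_zero hd).eventually_ne (by rwa [ev_zero])
    obtain ⟨z, h2, h3⟩ := (hfd.and_eventually h1).exists
    exact h3 h2.2.2
  have hdY : ∀ᶠ z in 𝓝 (0 : ℝ × ℝ), ¬ (z.1 ≠ 0 ∧ fderiv ℝ φ z = 0 ∧ ev (dY d) z = 0) := by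
    by_contra hcon
    have := hmin (k - 1) (by omega) (dY d) hd.dY hcon
    have h1 : k - 1 + 1 = k := by omega
    simp only [dY, h1, mul_eq_zero, hk, or_false] at this
    have h2 : ((k - 1 : ℕ) : ℝ) + 1 > 0 := by positivity
    linarith
  have hR : ∀ i, ∀ᶠ z in 𝓝 (0 : ℝ × ℝ), ev d z = 0 → Ent i (fderiv ℝ φ z) = 0 := by
    intro i
    obtain ⟨R, hRc, hRk, hRe⟩ := weier hd (hcv i) k hk hk'
    have hR0 : R = 0 := by
      by_contra hne
      obtain ⟨a, d', j, h1, h2, h3, h4⟩ := hstep R hRc hne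
        ((hfd.and_eventually ((hce i).and hRe)).mono (by
          rintro z ⟨⟨h1, h2, h3⟩, h4, Q, h5⟩
          refine ⟨h1, h2, ?_⟩
          rw [← h4, h2, h3] at h5
          simpa using h5.symm))
      have hjk : j < k := by
        by_contra hj
        exact h4 (hRk (a, j) (not_lt.1 hj))
      exact h3 (hmin j hjk d' h1 h2)
    filter_upwards [hce i, hRe] with z h1 h2 h3
    obtain ⟨Q, h2⟩ := h2
    rw [h1, h2, h3, hR0]; simp [ev]
  have hD : ∀ᶠ z in 𝓝 (0 : ℝ × ℝ), ev d z = 0 → fderiv ℝ φ z = 0 := by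
    filter_upwards [eventually_all.2 hR] with z hz h0
    exact Ent_zero fun i => hz i h0
  obtain ⟨q, ⟨hq1, hq2, hq3⟩, hq4, hq5, hq6, hq7⟩ := (hfd.and_eventually (hD.eventually_nhds.and
    ((ev_hasStrictFDerivAt hd).eventually_nhds.and ((ev_hasFDerivAt hd.dY).and hdY)))).exists
  have hb : ev (dY d) q ≠ 0 := fun h => hq7 ⟨hq1, hq2, h⟩
  exact arc_contra hφ ho q hq5 (hq6.continuousAt.eventually_ne hb) hq3 hq4

lemma locHomeo {f : EuclideanSpace ℝ (Fin 2) → EuclideanSpace ℝ (Fin 2)}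
    (hc : Continuous f) (ho : IsOpenMap f) {N : Set (EuclideanSpace ℝ (Fin 2))} (hN : IsOpen N)
    {q : EuclideanSpace ℝ (Fin 2)} (hq : q ∈ N) (hi : InjOn f N) : IsLocalHomeomorphOn f {q} := by
  rw [isLocalHomeomorphOn_iff_isOpenEmbedding_restrict]
  rintro x rfl
  refine ⟨N, hN.mem_nhds hq, ?_⟩
  exact .of_continuous_injective_isOpenMap (hc.comp continuous_subtype_val)
    (injOn_iff_injective.1 hi) (ho.comp hN.isOpenMap_subtype_val)

lemma noncrit {f : EuclideanSpace ℝ (Fin 2) → EuclideanSpace ℝ (Fin 2)}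
    (hf : ∀ p, AnalyticAt ℝ f p) (ho : IsOpenMap f) (e : EuclideanSpace ℝ (Fin 2) ≃L[ℝ] (ℝ × ℝ))
    {q : EuclideanSpace ℝ (Fin 2)} (hq : fderiv ℝ f q ≠ 0) : IsLocalHomeomorphOn f {q} := by
  have hc : Continuous f := continuous_iff_continuousAt.2 fun p => (hf p).continuousAt
  have key : ∀ e₁ : EuclideanSpace ℝ (Fin 2) ≃L[ℝ] (ℝ × ℝ),
      ((ContinuousLinearMap.fst ℝ ℝ ℝ).comp (e₁ : EuclideanSpace ℝ (Fin 2) →L[ℝ] (ℝ × ℝ))).comp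
        (fderiv ℝ f q) ≠ 0 → IsLocalHomeomorphOn f {q} := by
    intro e₁ hne
    have h1 : HasStrictFDerivAt f (fderiv ℝ f q) (e.symm (e q)) := by
      rw [e.symm_apply_apply]; exact (hf q).hasStrictFDerivAt
    have h2 : HasStrictFDerivAt (fun z => f (e.symm z))
        ((fderiv ℝ f q).comp (e.symm : (ℝ × ℝ) →L[ℝ] EuclideanSpace ℝ (Fin 2))) (e q) :=
      h1.comp (e q) e.symm.hasStrictFDerivAt
    have h3 := (((ContinuousLinearMap.fst ℝ ℝ ℝ).comp
      (e₁ : EuclideanSpace ℝ (Fin 2) →L[ℝ] (ℝ × ℝ))).hasStrictFDerivAt).comp (e q) h2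
    obtain ⟨N, hN, hqN, hinj⟩ := rank_one (φ := fun z => e₁ (f (e.symm z)))
      (e₁.continuous.comp (hc.comp e.symm.continuous))
      (e₁.toHomeomorph.isOpenMap.comp (ho.comp e.symm.toHomeomorph.isOpenMap)) (e q) _ h3
      (by
        intro h0
        apply hne
        ext v
        have := congrArg (fun L => L (e v)) h0
        simpa using this)
    refine locHomeo hc ho (hN.preimage e.continuous) hqN ?_
    intro x hx y hy hxy
    exact e.injective (hinj hx hy (by simp [hxy]))
  by_cases h : ((ContinuousLinearMap.fst ℝ ℝ ℝ).comp (e : EuclideanSpace ℝ (Fin 2) →L[ℝ] (ℝ × ℝ))).comp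
        (fderiv ℝ f q) = 0
  · refine key (e.trans (ContinuousLinearEquiv.prodComm ℝ ℝ ℝ)) fun h' => hq ?_
    ext1 v
    apply e.injective
    have h1 := congrArg (fun L => L v) h
    have h2 := congrArg (fun L => L v) h'
    simp at h1 h2
    exact Prod.ext (by simpa using h1) (by simpa using h2)
  · exact key e h

lemma crit_isol {f : EuclideanSpace ℝ (Fin 2) → EuclideanSpace ℝ (Fin 2)}
    (hf : ∀ p, AnalyticAt ℝ f p) (ho : IsOpenMap f) (e : EuclideanSpace ℝ (Fin 2) ≃L[ℝ] (ℝ × ℝ))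
    (p : EuclideanSpace ℝ (Fin 2)) : ∀ᶠ q in 𝓝 p, (e (q - p)).1 ≠ 0 → fderiv ℝ f q ≠ 0 := by
  let T : ℝ × ℝ → EuclideanSpace ℝ (Fin 2) := fun z => e.symm z + p
  have hT : ∀ z, HasFDerivAt T (e.symm : (ℝ × ℝ) →L[ℝ] EuclideanSpace ℝ (Fin 2)) z := fun z =>
    e.symm.hasFDerivAt.add_const p
  have hTo : IsOpenMap T := (Homeomorph.addRight p).isOpenMap.comp e.symm.toHomeomorph.isOpenMap
  have hTa : ∀ z, AnalyticAt ℝ T z := fun z =>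
    ((e.symm : (ℝ × ℝ) →L[ℝ] EuclideanSpace ℝ (Fin 2)).analyticAt z).fun_add analyticAt_const
  have h := main_crit (φ := fun z => e (f (T z)))
    (fun z => ((e : EuclideanSpace ℝ (Fin 2) →L[ℝ] (ℝ × ℝ)).analyticAt _).comp
      ((hf (T z)).comp (hTa z)))
    (e.toHomeomorph.isOpenMap.comp (ho.comp hTo))
  rw [not_frequently] at h
  have ht : Tendsto (fun q => e (q - p)) (𝓝 p) (𝓝 0) := by
    have : ContinuousAt (fun q => e (q - p)) p := by fun_prop
    simpa [ContinuousAt] using this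
  filter_upwards [ht.eventually h] with q hq h1 h2
  refine hq ⟨h1, ?_⟩
  have hTq : T (e (q - p)) = q := by simp [T]
  have h3 : HasFDerivAt f (0 : EuclideanSpace ℝ (Fin 2) →L[ℝ] EuclideanSpace ℝ (Fin 2))
      (T (e (q - p))) := by
    rw [hTq, ← h2]; exact (hf q).differentiableAt.hasFDerivAt
  have h4 := (e.hasFDerivAt.comp _ (h3.comp _ (hT (e (q - p))))).fderiv
  simpa [Function.comp_def] using h4

/-- For a real analytic open map `f : ℝ² → ℝ²`, the branch set (the set of
points where `f` is not a local homeomorphism) is closed and discrete. -/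
theorem branch_set_closed_discrete_dim_two
    (f : EuclideanSpace ℝ (Fin 2) → EuclideanSpace ℝ (Fin 2))
    (hf : ∀ p, AnalyticAt ℝ f p) (hopen : IsOpenMap f) :
    IsClosed {p : EuclideanSpace ℝ (Fin 2) | ¬ IsLocalHomeomorphOn f {p}} ∧
    ∀ p ∈ {p : EuclideanSpace ℝ (Fin 2) | ¬ IsLocalHomeomorphOn f {p}},
      ∃ U : Set (EuclideanSpace ℝ (Fin 2)), IsOpen U ∧ p ∈ U ∧
        {q : EuclideanSpace ℝ (Fin 2) | ¬ IsLocalHomeomorphOn f {q}} ∩ U = {p} := by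
  constructor
  · rw [← isOpen_compl_iff, isOpen_iff_mem_nhds]
    intro p hp
    have hp' : IsLocalHomeomorphOn f {p} := by simpa using hp
    obtain ⟨H, hpH, hH⟩ := hp' p rfl
    filter_upwards [H.open_source.mem_nhds hpH] with q hq
    simp only [mem_compl_iff, mem_ofPred_eq, not_not]
    rintro x rfl
    exact ⟨H, hq, hH⟩
  · intro p hp
    let e : EuclideanSpace ℝ (Fin 2) ≃L[ℝ] (ℝ × ℝ) :=
      ContinuousLinearEquiv.ofFinrankEq (by simp)
    obtain ⟨U, hU, hUo, hpU⟩ := eventually_nhds_iff.1 ((crit_isol hf hopen e p).and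
      (crit_isol hf hopen (e.trans (ContinuousLinearEquiv.prodComm ℝ ℝ ℝ)) p))
    refine ⟨U, hUo, hpU, ?_⟩
    apply subset_antisymm
    · rintro q ⟨hq, hqU⟩
      by_contra hne
      apply hq
      apply noncrit hf hopen e
      obtain ⟨h1, h2⟩ := hU q hqU
      by_cases h3 : (e (q - p)).1 = 0
      · refine h2 fun h4 => hne ?_
        have h5 : e (q - p) = 0 := Prod.ext h3 (by simpa using h4)
        simpa [sub_eq_zero] using h5
      · exact h1 h3
    · rintro q rfl
      exact ⟨hp, hpU⟩
end

section
/- Let f : ℝ² → ℝ² be a real analytic open map. Then f is light: for every q ∈ ℝ², the fiber f⁻¹({q}) is a totally disconnected (hence 0-dimensional) subset of ℝ². -/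
open Set Filter Topology

/-- Sign of a function with a zero of order `m` at `c` and nonnegative `m`-th derivative. -/
lemma light_sign (m : ℕ) : ∀ (φ : ℕ → ℝ → ℝ) (c y : ℝ)
    (_ : ∀ j t, HasDerivAt (φ j) (φ (j + 1) t) t)
    (_ : ∀ j < m, φ j c = 0) (_ : ∀ t ∈ uIcc c y, 0 ≤ φ m t), 0 ≤ φ 0 y * (y - c) ^ m := by
  induction m with
  | zero => intro φ c y _ _ h; simpa using h y right_mem_uIcc
  | succ m ih =>
    intro φ c y hd h0 hm
    have key : ∀ ξ ∈ uIcc c y, 0 ≤ φ 1 ξ * (ξ - c) ^ m := by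
      intro ξ hξ
      refine ih (fun j => φ (j + 1)) c ξ (fun j t => hd (j + 1) t)
        (fun j hj => h0 (j + 1) (by omega)) (fun t ht => hm t ?_)
      exact uIcc_subset_uIcc_left hξ ht
    have hc : φ 0 c = 0 := h0 0 (by omega)
    have mvt : y ≠ c → ∃ ξ ∈ uIcc c y, ∃ κ : ℝ, 0 < κ ∧ y - c = κ * (ξ - c) ∧
        φ 0 y = φ 1 ξ * (y - c) := by
      intro hne
      have hcont : Continuous (φ 0) :=
        continuous_iff_continuousAt.2 fun t => (hd 0 t).continuousAt
      rcases lt_or_gt_of_ne hne with h | h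
      · obtain ⟨ξ, hξ, he⟩ := exists_hasDerivAt_eq_slope (φ 0) (φ 1) h hcont.continuousOn
          (fun t _ => hd 0 t)
        have h1 : c - y ≠ 0 := by linarith
        have h2 : ξ - c < 0 := by linarith [hξ.2]
        refine ⟨ξ, ?_, (y - c) / (ξ - c), div_pos_of_neg_of_neg (by linarith) h2, ?_, ?_⟩
        · rw [uIcc_of_ge h.le]; exact ⟨hξ.1.le, hξ.2.le⟩
        · field_simp [h2.ne]
        · rw [he, hc]; field_simp; ring
      · obtain ⟨ξ, hξ, he⟩ := exists_hasDerivAt_eq_slope (φ 0) (φ 1) h hcont.continuousOn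
          (fun t _ => hd 0 t)
        have h1 : y - c ≠ 0 := by linarith
        have h2 : 0 < ξ - c := by linarith [hξ.1]
        refine ⟨ξ, ?_, (y - c) / (ξ - c), div_pos (by linarith) h2, ?_, ?_⟩
        · rw [uIcc_of_le h.le]; exact ⟨hξ.1.le, hξ.2.le⟩
        · field_simp [h2.ne']
        · rw [he, hc]; field_simp; ring
    by_cases hy : y = c
    · subst hy; simp
    · obtain ⟨ξ, hξ, κ, hκ, h1, h2⟩ := mvt hy
      have : φ 0 y * (y - c) ^ (m + 1) = (φ 1 ξ * (ξ - c) ^ m) * (κ ^ m * (y - c) ^ 2) := by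
        rw [h2, pow_succ, show (y - c) ^ m = κ ^ m * (ξ - c) ^ m by rw [h1, mul_pow]]; ring
      rw [this]
      have := key ξ hξ
      positivity

/-- The `j`-th partial derivative in the second variable. -/
noncomputable def lightD (u : ℝ × ℝ → ℝ) (j : ℕ) (z : ℝ × ℝ) : ℝ :=
  iteratedDeriv j (fun t => u (z.1, t)) z.2

lemma lightD_zero (u : ℝ × ℝ → ℝ) : lightD u 0 = u := by
  funext z; simp [lightD]

lemma lightD_succ (u : ℝ × ℝ → ℝ) (j : ℕ) (z : ℝ × ℝ) :
    lightD u (j + 1) z = deriv (fun t => lightD u j (z.1, t)) z.2 := by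
  simp [lightD, iteratedDeriv_succ]

lemma light_hasDerivAt {g : ℝ × ℝ → ℝ} {z : ℝ × ℝ} (hg : DifferentiableAt ℝ g z) :
    HasDerivAt (fun t => g (z.1, t)) (fderiv ℝ g z (0, 1)) z.2 := by
  have h1 : HasDerivAt (fun t : ℝ => (z.1, t)) ((0 : ℝ), (1 : ℝ)) z.2 :=
    (hasDerivAt_const _ _).prodMk (hasDerivAt_id _)
  exact HasFDerivAt.comp_hasDerivAt (l := g) z.2 hg.hasFDerivAt h1

lemma lightD_analytic {u : ℝ × ℝ → ℝ} (hu : ∀ z, AnalyticAt ℝ u z) (j : ℕ) :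
    ∀ z, AnalyticAt ℝ (lightD u j) z := by
  induction j with
  | zero => simpa [lightD_zero] using hu
  | succ j ih =>
    have : lightD u (j + 1) = fun z => fderiv ℝ (lightD u j) z (0, 1) := by
      funext z
      rw [lightD_succ, (light_hasDerivAt (ih z).differentiableAt).deriv]
    rw [this]
    intro z
    exact AnalyticAt.comp (g := ContinuousLinearMap.apply ℝ ℝ ((0 : ℝ), (1 : ℝ)))
      (ContinuousLinearMap.analyticAt _ _) (ih z).fderiv

lemma lightD_fderiv {u : ℝ × ℝ → ℝ} (hu : ∀ z, AnalyticAt ℝ u z) (j : ℕ) (z : ℝ × ℝ) :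
    lightD u (j + 1) z = fderiv ℝ (lightD u j) z (0, 1) := by
  rw [lightD_succ, (light_hasDerivAt (lightD_analytic hu j z).differentiableAt).deriv]

lemma lightD_hasDerivAt {u : ℝ × ℝ → ℝ} (hu : ∀ z, AnalyticAt ℝ u z) (j : ℕ) (x y : ℝ) :
    HasDerivAt (fun t => lightD u j (x, t)) (lightD u (j + 1) (x, y)) y := by
  rw [lightD_fderiv hu]
  exact light_hasDerivAt (z := (x, y)) (lightD_analytic hu j _).differentiableAt

lemma lightD_lin {u v : ℝ × ℝ → ℝ} (hu : ∀ z, AnalyticAt ℝ u z) (hv : ∀ z, AnalyticAt ℝ v z)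
    (α β : ℝ) (j : ℕ) :
    lightD (fun z => α * u z + β * v z) j = fun z => α * lightD u j z + β * lightD v j z := by
  induction j with
  | zero => simp [lightD_zero]
  | succ j ih =>
    funext z
    rw [lightD_succ, ih]
    exact (((lightD_hasDerivAt hu j z.1 z.2).const_mul α).add
      ((lightD_hasDerivAt hv j z.1 z.2).const_mul β)).deriv

/-- If all vertical derivatives vanish at a point, the function vanishes on the vertical line. -/
lemma light_line {u : ℝ × ℝ → ℝ} (hu : ∀ z, AnalyticAt ℝ u z) (p : ℝ × ℝ)
    (h : ∀ j, lightD u j p = 0) (y : ℝ) : u (p.1, y) = 0 := by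
  have han : ∀ t, AnalyticAt ℝ (fun t => u (p.1, t)) t := fun t =>
    AnalyticAt.comp (g := u) (f := fun t : ℝ => (p.1, t)) (hu _) (analyticAt_const.prod analyticAt_id)
  have htop : analyticOrderAt (fun t => u (p.1, t)) p.2 = ⊤ := by
    rw [ENat.eq_top_iff_forall_ge]
    intro n
    exact (natCast_le_analyticOrderAt_iff_iteratedDeriv_eq_zero (han _)).2 fun i _ => h i
  have hev := analyticOrderAt_eq_top.1 htop
  exact AnalyticOnNhd.eqOn_zero_of_preconnected_of_eventuallyEq_zero
    (U := univ) (fun t _ => han t) isPreconnected_univ (mem_univ p.2) hev (mem_univ y)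

/-- Local step: at a point `p` where `a` has vertical order exactly `m ≥ 1`. -/
lemma light_local {a b : ℝ × ℝ → ℝ} (ha : ∀ z, AnalyticAt ℝ a z) (hb : ∀ z, AnalyticAt ℝ b z)
    {C : Set (ℝ × ℝ)} (hC : Preperfect C) {p : ℝ × ℝ} (hp : p ∈ C) (n : ℕ)
    (ha0 : ∀ z ∈ C, ∀ j ≤ n, lightD a j z = 0) (hb0 : ∀ z ∈ C, ∀ j ≤ n, lightD b j z = 0)
    (hap : 0 < lightD a (n + 1) p) (hbp : lightD b (n + 1) p = 0) :
    ∀ᶠ z in 𝓝 p, a z = 0 → b z = 0 := by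
  have hw := lightD_analytic ha n p
  have hcd : ContDiffAt ℝ (⊤ : WithTop ℕ∞) (lightD a n) p := hw.contDiffAt
  have hinv : (fderiv ℝ (lightD a n) p ∘L .inr ℝ ℝ ℝ).IsInvertible := by
    have hne : lightD a (n + 1) p ≠ 0 := hap.ne'
    refine ⟨ContinuousLinearEquiv.unitsEquivAut ℝ (Units.mk0 _ hne), ?_⟩
    ext
    simp [lightD_fderiv ha]
  have htop : (⊤ : WithTop ℕ∞) ≠ 0 := by simp
  obtain ⟨g, hg, hgp, hgiff⟩ : ∃ g : ℝ → ℝ, AnalyticAt ℝ g p.1 ∧ g p.1 = p.2 ∧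
      ∀ᶠ z in 𝓝 p, lightD a n z = 0 → g z.1 = z.2 := by
    refine ⟨hcd.implicitFunction htop hinv, (hcd.contDiffAt_implicitFunction htop hinv).analyticAt,
      hcd.implicitFunction_apply_self htop hinv, ?_⟩
    filter_upwards [hcd.eventually_apply_eq_iff_implicitFunction htop hinv] with z hz h
    exact hz.1 (by rw [h, ha0 p hp n le_rfl])
  have hpg : (p.1, g p.1) = p := by rw [hgp]
  have hgan : AnalyticAt ℝ (fun x => (x, g x)) p.1 := analyticAt_id.prod hg
  -- the curve stays in the zero set
  have hfreq : ∃ᶠ x in 𝓝[≠] p.1, (x, g x) ∈ C := by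
    have h1 : ∃ᶠ z in 𝓝[≠] p, z ∈ C := accPt_iff_frequently_nhdsNE.1 (hC p hp)
    have h2 : ∃ᶠ z in 𝓝[≠] p, (z.1, g z.1) ∈ C ∧ z.1 ≠ p.1 := by
      have h3 : ∀ᶠ z in 𝓝[≠] p, lightD a n z = 0 → g z.1 = z.2 := hgiff.filter_mono inf_le_left
      have h4 : ∀ᶠ z in 𝓝[≠] p, z ≠ p := eventually_mem_nhdsWithin
      refine (h1.and_eventually (h3.and h4)).mono ?_
      rintro z ⟨hz, h5, h6⟩
      have h7 := h5 (ha0 z hz n le_rfl)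
      refine ⟨by rw [h7]; exact hz, fun h8 => h6 ?_⟩
      ext
      · exact h8
      · rw [← h7, h8, hgp]
    rw [frequently_nhdsWithin_iff]
    have h3 : ∃ᶠ z in 𝓝 p, (z.1, g z.1) ∈ C ∧ z.1 ≠ p.1 := h2.filter_mono inf_le_left
    exact (continuous_fst.tendsto p).frequently h3
  have hvan : ∀ {u : ℝ × ℝ → ℝ}, (∀ z, AnalyticAt ℝ u z) →
      (∀ z ∈ C, ∀ j ≤ n, lightD u j z = 0) →
      ∀ᶠ x in 𝓝 p.1, ∀ j < n + 1, lightD u j (x, g x) = 0 := by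
    intro u hu hu0
    have : ∀ j ∈ Finset.range (n + 1), ∀ᶠ x in 𝓝 p.1, lightD u j (x, g x) = 0 := by
      intro j hj
      have han : AnalyticAt ℝ (fun x => lightD u j (x, g x)) p.1 :=
        AnalyticAt.comp (g := lightD u j) (f := fun x => (x, g x)) (lightD_analytic hu j _) hgan
      refine han.frequently_zero_iff_eventually_zero.1 (hfreq.mono fun x hx => ?_)
      exact hu0 _ hx j (by simpa [Nat.lt_succ_iff] using hj)
    filter_upwards [(Filter.eventually_all_finset _).2 this] with x hx j hj
    exact hx j (by simpa using hj)
  -- the box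
  have hbox : ∀ᶠ z in 𝓝 p, |lightD b (n + 1) z| < lightD a (n + 1) z := by
    have h1 : ContinuousAt (fun z => |lightD b (n + 1) z|) p :=
      (lightD_analytic hb (n + 1) p).continuousAt.abs
    have h2 := (lightD_analytic ha (n + 1) p).continuousAt
    exact h1.eventually_lt h2 (by simpa [hbp] using hap)
  obtain ⟨r, hr, hball⟩ := Metric.eventually_nhds_iff_ball.1 hbox
  have hgr : ∀ᶠ x in 𝓝 p.1, g x ∈ Metric.ball p.2 r := by
    apply hg.continuousAt
    rw [hgp]
    exact Metric.ball_mem_nhds _ hr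
  have hxs : ∀ᶠ x in 𝓝 p.1, x ∈ Metric.ball p.1 r ∧ g x ∈ Metric.ball p.2 r ∧
      (∀ j < n + 1, lightD a j (x, g x) = 0) ∧ (∀ j < n + 1, lightD b j (x, g x) = 0) := by
    filter_upwards [hgr, hvan ha ha0, hvan hb hb0, Metric.ball_mem_nhds p.1 hr] with x h1 h2 h3 h4
    exact ⟨h4, h1, h2, h3⟩
  have hxs' := (continuous_fst.tendsto p).eventually hxs
  filter_upwards [hxs', (continuous_snd.tendsto p).eventually (Metric.ball_mem_nhds p.2 hr)]
    with z hz hz2 haz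
  obtain ⟨hx, hgx, h1, h2⟩ := hz
  have hseg : ∀ t ∈ uIcc (g z.1) z.2, |lightD b (n + 1) (z.1, t)| < lightD a (n + 1) (z.1, t) := by
    intro t ht
    apply hball
    rw [← ball_prod_same]
    refine ⟨hx, ?_⟩
    have hcv : Convex ℝ (Metric.ball p.2 r) := convex_ball _ _
    rw [← segment_eq_uIcc] at ht
    exact hcv.segment_subset hgx hz2 ht
  have s1 := light_sign (n + 1) (fun j t => lightD a j (z.1, t) + lightD b j (z.1, t)) (g z.1) z.2
    (fun j t => (lightD_hasDerivAt ha j _ t).add (lightD_hasDerivAt hb j _ t))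
    (fun j hj => by simp [h1 j hj, h2 j hj])
    (fun t ht => by have := abs_lt.1 (hseg t ht); linarith)
  have s2 := light_sign (n + 1) (fun j t => lightD a j (z.1, t) - lightD b j (z.1, t)) (g z.1) z.2
    (fun j t => (lightD_hasDerivAt ha j _ t).sub (lightD_hasDerivAt hb j _ t))
    (fun j hj => by simp [h1 j hj, h2 j hj])
    (fun t ht => by have := abs_lt.1 (hseg t ht); linarith)
  simp only [lightD_zero, Prod.mk.eta, haz, zero_add, zero_sub] at s1 s2
  have s3 : b z * (z.2 - g z.1) ^ (n + 1) = 0 := by linarith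
  rcases mul_eq_zero.1 s3 with h | h
  · exact h
  · have h5 : z.2 = g z.1 := sub_eq_zero.1 (pow_eq_zero_iff (by omega) |>.1 h)
    have h6 := h2 0 (by omega)
    rw [lightD_zero, ← h5] at h6
    exact h6

lemma light_core {u v : ℝ × ℝ → ℝ} (hu : ∀ z, AnalyticAt ℝ u z) (hv : ∀ z, AnalyticAt ℝ v z)
    (hopen : IsOpenMap fun z => (u z, v z)) {C : Set (ℝ × ℝ)} (hC : IsPreconnected C)
    (hu0 : ∀ z ∈ C, u z = 0) (hv0 : ∀ z ∈ C, v z = 0)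
    {p₁ p₂ : ℝ × ℝ} (h₁ : p₁ ∈ C) (h₂ : p₂ ∈ C) (hlt : p₁.1 < p₂.1) : False := by
  have hex : ∃ m, ∃ p ∈ C, lightD u m p ≠ 0 ∨ lightD v m p ≠ 0 := by
    by_contra! hno
    have himg : IsPreconnected (Prod.fst '' C) := hC.image _ continuous_fst.continuousOn
    have hsub : Icc p₁.1 p₂.1 ⊆ Prod.fst '' C :=
      himg.Icc_subset (mem_image_of_mem _ h₁) (mem_image_of_mem _ h₂)
    have hop := hopen (Ioo p₁.1 p₂.1 ×ˢ univ) (isOpen_Ioo.prod isOpen_univ)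
    have heq : (fun z => (u z, v z)) '' (Ioo p₁.1 p₂.1 ×ˢ univ) = {((0 : ℝ), (0 : ℝ))} := by
      apply Subset.antisymm
      · rintro _ ⟨z, ⟨hz, -⟩, rfl⟩
        obtain ⟨c, hc, hcz⟩ := hsub ⟨hz.1.le, hz.2.le⟩
        have e1 := light_line hu c (fun j => (hno j c hc).1) z.2
        have e2 := light_line hv c (fun j => (hno j c hc).2) z.2
        rw [hcz] at e1 e2
        simp only [mem_singleton_iff, Prod.mk.injEq]
        exact ⟨e1, e2⟩
      · rintro _ rfl
        obtain ⟨x, hx⟩ := exists_between hlt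
        obtain ⟨c, hc, hcz⟩ := hsub ⟨hx.1.le, hx.2.le⟩
        refine ⟨c, ⟨by rw [hcz]; exact hx, mem_univ _⟩, ?_⟩
        simp [hu0 c hc, hv0 c hc]
    rw [heq] at hop
    exact not_isOpen_singleton _ hop
  classical
  obtain ⟨p, hp, hne⟩ := Nat.find_spec hex
  have hmin : ∀ j < Nat.find hex, ∀ z ∈ C, lightD u j z = 0 ∧ lightD v j z = 0 := by
    intro j hj z hz
    have := Nat.find_min hex hj
    push Not at this
    exact this z hz
  generalize Nat.find hex = m at hne hmin
  obtain _ | n := m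
  · simp [lightD_zero, hu0 p hp, hv0 p hp] at hne
  have hperf : Preperfect C := hC.preperfect_of_nontrivial
    ⟨p₁, h₁, p₂, h₂, fun h => by rw [h] at hlt; exact lt_irrefl _ hlt⟩
  set α := lightD u (n + 1) p
  set β := lightD v (n + 1) p
  have hpos : 0 < α * α + β * β := by
    rcases hne with h | h
    · have := mul_self_pos.2 h; nlinarith [mul_self_nonneg β]
    · have := mul_self_pos.2 h; nlinarith [mul_self_nonneg α]
  have hloc := light_local (a := fun z => α * u z + β * v z) (b := fun z => (-β) * u z + α * v z)
    (fun z => (analyticAt_const.mul (hu z)).add (analyticAt_const.mul (hv z)))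
    (fun z => (analyticAt_const.mul (hu z)).add (analyticAt_const.mul (hv z)))
    hperf hp n
    (fun z hz j hj => by
      obtain ⟨e1, e2⟩ := hmin j (by omega) z hz
      simp [lightD_lin hu hv, e1, e2])
    (fun z hz j hj => by
      obtain ⟨e1, e2⟩ := hmin j (by omega) z hz
      simp only [lightD_lin hu hv, e1, e2]; ring)
    (by simp only [lightD_lin hu hv]; exact hpos)
    (by simp only [lightD_lin hu hv]; change -β * α + α * β = 0; ring)
  have himg := hopen.image_mem_nhds hloc
  simp only [hu0 p hp, hv0 p hp] at himg
  have hcont : Tendsto (fun s : ℝ => (-β * s, α * s)) (𝓝[≠] 0) (𝓝 ((0 : ℝ), (0 : ℝ))) := by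
    have : Continuous (fun s : ℝ => (-β * s, α * s)) := by fun_prop
    have h := this.tendsto 0
    simp only [mul_zero] at h
    exact h.mono_left inf_le_left
  have hev : ∀ᶠ s : ℝ in 𝓝[≠] 0, s ≠ 0 := eventually_mem_nhdsWithin
  obtain ⟨s, ⟨z, hz, hzs⟩, hs⟩ := ((hcont.eventually himg).and hev).exists
  simp only [Prod.mk.injEq] at hzs
  obtain ⟨e1, e2⟩ := hzs
  have h3 : -β * u z + α * v z = 0 := hz (by rw [e1, e2]; ring)
  rw [e1, e2] at h3
  have h4 : (α * α + β * β) * s = 0 := by linarith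
  rcases mul_eq_zero.1 h4 with h | h
  · exact hpos.ne' h
  · exact hs h

lemma light_wrap {f : EuclideanSpace ℝ (Fin 2) → EuclideanSpace ℝ (Fin 2)}
    (hf : ∀ p, AnalyticAt ℝ f p) (hopen : IsOpenMap f)
    (L : (ℝ × ℝ) ≃L[ℝ] EuclideanSpace ℝ (Fin 2)) {q : EuclideanSpace ℝ (Fin 2)}
    {C : Set (EuclideanSpace ℝ (Fin 2))} (hCf : C ⊆ f ⁻¹' {q}) (hC : IsPreconnected C)
    {p₁ p₂ : EuclideanSpace ℝ (Fin 2)} (h₁ : p₁ ∈ C) (h₂ : p₂ ∈ C) :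
    (L.symm p₁).1 = (L.symm p₂).1 := by
  let F : ℝ × ℝ → ℝ × ℝ := fun z => L.symm (f (L z) - q)
  have hF : ∀ z, AnalyticAt ℝ F z := by
    intro z
    have h1 : AnalyticAt ℝ (fun z => f (L z) - q) z :=
      (AnalyticAt.comp (g := f) (f := L) (hf _) (L.toContinuousLinearMap.analyticAt z)).sub
        analyticAt_const
    exact AnalyticAt.comp (g := L.symm) (L.symm.toContinuousLinearMap.analyticAt _) h1
  have hFo : IsOpenMap F :=
    L.symm.toHomeomorph.isOpenMap.comp
      ((Homeomorph.subRight q).isOpenMap.comp (hopen.comp L.toHomeomorph.isOpenMap))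
  have hC' : IsPreconnected (L.symm '' C) := hC.image _ L.symm.continuous.continuousOn
  have hz : ∀ z ∈ L.symm '' C, F z = 0 := by
    rintro _ ⟨c, hc, rfl⟩
    have : f c = q := hCf hc
    simp [F, this]
  have hu : ∀ z, AnalyticAt ℝ (fun z => (F z).1) z := fun z =>
    AnalyticAt.comp (g := Prod.fst) analyticAt_fst (hF z)
  have hv : ∀ z, AnalyticAt ℝ (fun z => (F z).2) z := fun z =>
    AnalyticAt.comp (g := Prod.snd) analyticAt_snd (hF z)
  have key : ∀ {a b}, a ∈ C → b ∈ C → ¬ (L.symm a).1 < (L.symm b).1 := fun ha hb hlt =>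
    light_core hu hv hFo hC' (fun z h => by rw [hz z h]; rfl) (fun z h => by rw [hz z h]; rfl)
      (mem_image_of_mem _ ha) (mem_image_of_mem _ hb) hlt
  exact le_antisymm (not_lt.1 (key h₂ h₁)) (not_lt.1 (key h₁ h₂))

/-- A real analytic open map `f : ℝ² → ℝ²` is light: every fiber is
totally disconnected. -/
theorem analytic_open_map_dim_two_is_light
    (f : EuclideanSpace ℝ (Fin 2) → EuclideanSpace ℝ (Fin 2))
    (hf : ∀ p, AnalyticAt ℝ f p) (hopen : IsOpenMap f) :
    ∀ q : EuclideanSpace ℝ (Fin 2), IsTotallyDisconnected (f ⁻¹' {q}) := by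
  intro q C hCf hC p₁ h₁ p₂ h₂
  let L : EuclideanSpace ℝ (Fin 2) ≃L[ℝ] (ℝ × ℝ) :=
    (EuclideanSpace.equiv (Fin 2) ℝ).trans (ContinuousLinearEquiv.finTwoArrow ℝ ℝ)
  have e1 := light_wrap hf hopen L.symm hCf hC h₁ h₂
  have e2 := light_wrap hf hopen (L.trans (ContinuousLinearEquiv.prodComm ℝ ℝ ℝ)).symm hCf hC h₁ h₂
  simp [L] at e1 e2
  ext i
  fin_cases i
  · exact e1
  · exact e2
end
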